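/- arXiv:1909.01898 — 2 statements merged into one kernel-verified Lean document; each statement's English description precedes it below -/
import Mathlib

section
/- Consider a commutative diagram of schemes consisting of closed immersions i_X : X₀ → X, i_C : C₀ → C, i_Y : Y₀ → Y, morphisms π₁ : C → X and π₂ : C → Y, and morphisms C₀ → X₀, C₀ → Y₀ making both squares commute. Assume: (a) as a subset of the topological space of C, the image of C₀ coincides both with the preimage under π₁ of the image of X₀ and with the preimage under π₂ of the image of Y₀; (b) the schemes X, X₀ and Y₀ are affine; (c) π₁ and π₂ are proper and surjective; (d) the restrictions of π₁ and π₂ to the open subscheme C ∖ C₀ are finite morphisms onto X ∖ X₀ and Y ∖ Y₀ respectively. Then the scheme Y is affine. -/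
open AlgebraicGeometry CategoryTheory

/-- The target of a universally closed surjection out of a separated scheme is separated. -/
theorem AlgebraicGeometry.Scheme.isSeparated_of_universallyClosed_of_surjective {C Y : Scheme}
    (p : C ⟶ Y) [hp : UniversallyClosed p] [Surjective p] [C.IsSeparated] : Y.IsSeparated := by
  constructor
  constructor
  refine IsClosedImmersion.of_isPreimmersion _ ?_
  let m : Limits.pullback (Limits.terminal.from C) (Limits.terminal.from C) ⟶
      Limits.pullback (Limits.terminal.from Y) (Limits.terminal.from Y) :=
    Limits.pullback.map _ _ _ _ p p (𝟙 _) (by simp) (by simp)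
  have h1 : p ≫ Limits.pullback.diagonal (Limits.terminal.from Y) =
      Limits.pullback.diagonal (Limits.terminal.from C) ≫ m := by
    apply Limits.pullback.hom_ext
    · rw [Category.assoc, Category.assoc, Limits.pullback.lift_fst]; simp
    · rw [Category.assoc, Category.assoc, Limits.pullback.lift_snd]; simp
  have : UniversallyClosed m :=
    MorphismProperty.pullbackMap (P := @UniversallyClosed) (i₁ := p) (i₂ := p) hp hp (by simp) (by simp)
  have h2 : UniversallyClosed (p ≫ Limits.pullback.diagonal (Limits.terminal.from Y)) := by
    rw [h1]; infer_instance
  have h3 := (p ≫ Limits.pullback.diagonal (Limits.terminal.from Y)).isClosedMap.isClosed_range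
  rwa [Scheme.Hom.comp_base, TopCat.coe_comp, p.surjective.range_comp] at h3

namespace AlgebraicGeometry.Scheme

/-- Restriction of sections as a ring homomorphism. -/
noncomputable def res (Y : Scheme) {U V : Y.Opens} (h : V ≤ U) : Γ(Y, U) →+* Γ(Y, V) :=
  (Y.presheaf.map (homOfLE h).op).hom

@[simp]
theorem res_res {Y : Scheme} {U V W : Y.Opens} (h : V ≤ U) (h' : W ≤ V) (c : Γ(Y, U)) :
    Y.res h' (Y.res h c) = Y.res (h'.trans h) c := by
  simp only [res, ← CommRingCat.comp_apply, ← Functor.map_comp]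
  rfl

@[simp]
theorem res_self {Y : Scheme} {U : Y.Opens} (c : Γ(Y, U)) : Y.res le_rfl c = c := by
  simp [res]

theorem basicOpen_res' {Y : Scheme} {U V : Y.Opens} (h : V ≤ U) (c : Γ(Y, U)) :
    Y.basicOpen (Y.res h c) = V ⊓ Y.basicOpen c :=
  Y.basicOpen_res c (homOfLE h).op

theorem app_res {X Y : Scheme} (f : X ⟶ Y) {U V : Y.Opens} (h : V ≤ U) (c : Γ(Y, U)) :
    f.app V (Y.res h c) = X.res ((TopologicalSpace.Opens.map f.base).monotone h) (f.app U c) := by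
  have := f.naturality (homOfLE h).op
  exact ConcreteCategory.congr_hom this c

/-- Every prime ideal of the global sections of an affine scheme comes from a point. -/
theorem exists_mem_basicOpen_iff_notMem {Z : Scheme} [IsAffine Z] (q : Ideal Γ(Z, ⊤)) [q.IsPrime] :
    ∃ x : Z, ∀ g : Γ(Z, ⊤), x ∈ Z.basicOpen g ↔ g ∉ q := by
  obtain ⟨x, hx⟩ := Z.toSpecΓ.homeomorph.surjective (⟨q, ‹_›⟩ : PrimeSpectrum Γ(Z, ⊤))
  refine ⟨x, fun g ↦ ?_⟩
  rw [← Z.toSpecΓ_preimage_basicOpen]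
  change Z.toSpecΓ.homeomorph x ∈ PrimeSpectrum.basicOpen g ↔ _
  rw [hx]
  rfl

theorem exists_affineOpens_le {Y : Scheme} {V : Y.Opens} {x : Y} (hx : x ∈ V) :
    ∃ U : Y.affineOpens, x ∈ U.1 ∧ U.1 ≤ V := by
  obtain ⟨_, ⟨U, hU, rfl⟩, hxU, hUV⟩ := Y.isBasis_affineOpens.exists_subset_of_mem_open hx V.2
  exact ⟨⟨U, hU⟩, hxU, hUV⟩

theorem section_ext {Y : Scheme} {V : Y.Opens} {ι : Type*} (U : ι → Y.Opens) (hU : ∀ i, U i ≤ V)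
    (hV : ∀ x ∈ V, ∃ i, x ∈ U i) {c d : Γ(Y, V)}
    (h : ∀ i, Y.res (hU i) c = Y.res (hU i) d) : c = d := by
  refine TopCat.Sheaf.eq_of_locally_eq' Y.sheaf U V
    (fun i ↦ homOfLE (hU i)) ?_ _ _ fun i ↦ h i
  intro x hx
  exact TopologicalSpace.Opens.mem_iSup.mpr (hV x hx)

/-- Two sections that agree on all smaller affine opens are equal. -/
theorem section_ext_of_affineOpens {Y : Scheme} {V : Y.Opens} {c d : Γ(Y, V)}
    (h : ∀ (U : Y.affineOpens) (hU : U.1 ≤ V), Y.res hU c = Y.res hU d) : c = d :=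
  section_ext (fun U : {U : Y.affineOpens // U.1 ≤ V} ↦ U.1.1) (fun U ↦ U.2)
    (fun x hx ↦ by
      obtain ⟨U, hxU, hUV⟩ := exists_affineOpens_le hx
      exact ⟨⟨U, hUV⟩, hxU⟩) fun U ↦ h U.1 U.2

theorem exists_glue {Y : Scheme} {ι : Type*} (U : ι → Y.Opens) (hU : ∀ x, ∃ i, x ∈ U i)
    (c : ∀ i, Γ(Y, U i))
    (h : ∀ i j, Y.res (inf_le_left : U i ⊓ U j ≤ _) (c i) = Y.res inf_le_right (c j)) :
    ∃ s : Γ(Y, ⊤), ∀ i, Y.res le_top s = c i := by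
  obtain ⟨s, hs, -⟩ := TopCat.Sheaf.existsUnique_gluing' Y.sheaf U ⊤
    (fun U ↦ homOfLE le_top) (fun x _ ↦ TopologicalSpace.Opens.mem_iSup.mpr (hU x)) c h
  exact ⟨s, hs⟩

/-- A compatible family of sections over all affine opens glues to a global section. -/
theorem exists_glue_affineOpens {Y : Scheme} (c : ∀ U : Y.affineOpens, Γ(Y, U.1))
    (h : ∀ (U V : Y.affineOpens) (hVU : V.1 ≤ U.1), Y.res hVU (c U) = c V) :
    ∃ s : Γ(Y, ⊤), ∀ U : Y.affineOpens, Y.res le_top s = c U := by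
  refine exists_glue _ (fun x ↦ ?_) c fun U V ↦ ?_
  · obtain ⟨U, hxU, -⟩ := exists_affineOpens_le (V := ⊤) (x := x) trivial
    exact ⟨U, hxU⟩
  · refine section_ext_of_affineOpens fun W hW ↦ ?_
    rw [res_res, res_res, h U W, h V W]

theorem mem_basicOpen_app {X Y : Scheme} (f : X ⟶ Y) (s : Γ(Y, ⊤)) (x : X) :
    x ∈ X.basicOpen (f.appTop s) ↔ f x ∈ Y.basicOpen s := by
  rw [← preimage_basicOpen_top]; rfl

theorem isAffineOpen_basicOpen_of_le {Y : Scheme} {U : Y.Opens} (hU : IsAffineOpen U)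
    {s : Γ(Y, ⊤)} (h : Y.basicOpen s ≤ U) : IsAffineOpen (Y.basicOpen s) := by
  have := hU.basicOpen (Y.res le_top s)
  rwa [basicOpen_res', inf_eq_right.mpr h] at this

theorem exists_mem_basicOpen_le {Z : Scheme} [IsAffine Z] {V : Z.Opens} {x : Z} (hx : x ∈ V) :
    ∃ g : Γ(Z, ⊤), x ∈ Z.basicOpen g ∧ Z.basicOpen g ≤ V := by
  obtain ⟨g, h1, h2⟩ := (isAffineOpen_top Z).exists_basicOpen_le ⟨x, hx⟩ trivial
  exact ⟨g, h2, h1⟩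

theorem res_res_of_eq {Y : Scheme} {U V : Y.Opens} (h : U = V) (x : Γ(Y, U)) :
    Y.res h.le (Y.res h.ge x) = x := by
  rw [res_res, res_self]

theorem IdealSheafData.res_mem_ideal_iff_of_eq {Z : Scheme} (J : Z.IdealSheafData)
    {V W : Z.affineOpens} (h : W.1 = V.1) (s : Γ(Z, V)) :
    Z.res h.le s ∈ J.ideal W ↔ s ∈ J.ideal V := by
  obtain ⟨V, hV⟩ := V
  obtain ⟨W, hW⟩ := W
  obtain rfl : W = V := h
  rw [res_self]

theorem IdealSheafData.mem_comap_ι_ideal {Z : Scheme} (J : Z.IdealSheafData) (V : Z.affineOpens)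
    [IsAffine V.1] (s : Γ(Z, V)) :
    (Z.res V.1.ι_image_top.le s : Γ(V.1, ⊤)) ∈ (J.comap V.1.ι).ideal ⟨⊤, isAffineOpen_top _⟩ ↔
      s ∈ J.ideal V := by
  rw [ideal_comap_of_isOpenImmersion, Opens.ι_appIso]
  exact J.res_mem_ideal_iff_of_eq
    (W := ⟨V.1.ι ''ᵁ ⊤, (isAffineOpen_top V.1).image_of_isOpenImmersion V.1.ι⟩) V.1.ι_image_top s

theorem IdealSheafData.comap_ideal_top_le {Y Z : Scheme} [IsAffine Y] [IsAffine Z]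
    (I : Y.IdealSheafData) (f : Z ⟶ Y) :
    (I.comap f).ideal ⟨⊤, isAffineOpen_top _⟩ ≤
      (I.ideal ⟨⊤, isAffineOpen_top _⟩).map f.appTop.hom := by
  have : I.comap f ≤ ofIdealTop ((I.ideal ⟨⊤, isAffineOpen_top _⟩).map f.appTop.hom) := by
    rw [← le_map_iff_comap_le]
    apply le_of_isAffine
    rw [ideal_map_of_isAffineHom, ← Ideal.map_le_iff_le_comap]
    intro s hs
    rw [ofIdealTop_ideal]
    have := Ideal.mem_map_of_mem (Z.presheaf.map (homOfLE (le_top (a := (⊤ : Z.Opens)))).op).hom hs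
    have e : (Z.presheaf.map (homOfLE (le_top (a := (⊤ : Z.Opens)))).op).hom s = s := res_self s
    exact e ▸ this
  refine (this _).trans_eq ?_
  rw [ofIdealTop_ideal]
  erw [CategoryTheory.Functor.map_id]
  exact (Ideal.map_id _)

theorem comap_ideal_le {Y Z : Scheme} (I : Y.IdealSheafData) (f : Z ⟶ Y) [IsAffineHom f]
    (U : Y.affineOpens) : (I.comap f).ideal ⟨_, U.2.preimage f⟩ ≤ (I.ideal U).map (f.app U).hom := by
  intro s hs
  have : IsAffine U.1 := U.2
  let V : Z.affineOpens := ⟨_, U.2.preimage f⟩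
  have : IsAffine V.1 := V.2
  have h1 := ((I.comap f).mem_comap_ι_ideal V s).mpr hs
  have e : V.1.ι ≫ f = (f ∣_ U.1) ≫ U.1.ι := (morphismRestrict_ι f U.1).symm
  rw [← IdealSheafData.comap_comp, e, IdealSheafData.comap_comp] at h1
  have h2 := IdealSheafData.comap_ideal_top_le _ _ h1
  have h3 : Ideal.comap (Z.res V.1.ι_image_top.le : _ →+* Γ(V.1, ⊤))
      (((I.comap U.1.ι).ideal ⟨⊤, isAffineOpen_top _⟩).map (f ∣_ U.1).appTop.hom) ≤
      (I.ideal U).map (f.app U).hom := by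
    have hb : Function.Bijective (Z.res V.1.ι_image_top.le : Γ(Z, V) →+* Γ(V.1, ⊤)) :=
      Function.bijective_iff_has_inverse.mpr ⟨Z.res V.1.ι_image_top.ge,
        fun x ↦ res_res_of_eq V.1.ι_image_top.symm x,
        fun x ↦ res_res_of_eq V.1.ι_image_top x⟩
    rw [← Ideal.comap_map_of_bijective _ hb (I := (I.ideal U).map (f.app U).hom)]
    refine Ideal.comap_mono ?_
    refine Ideal.map_le_iff_le_comap.mpr ?_
    intro x hx
    obtain ⟨t, rfl⟩ : ∃ t, x = Y.res U.1.ι_image_top.le t :=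
      ⟨Y.res U.1.ι_image_top.ge x, (res_res_of_eq U.1.ι_image_top x).symm⟩
    have ht := (I.mem_comap_ι_ideal U t).mp hx
    have := Ideal.mem_map_of_mem (Z.res V.1.ι_image_top.le : Γ(Z, V) →+* Γ(V.1, ⊤))
      (Ideal.mem_map_of_mem (f.app U).hom ht)
    have e2 : (f ∣_ U.1).appTop.hom (Y.res U.1.ι_image_top.le t) =
        Z.res V.1.ι_image_top.le (f.app U t) := by
      rw [morphismRestrict_appTop]
      change Z.res _ (f.app _ (Y.res _ t)) = _
      rw [app_res, res_res]
      rfl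
    refine Ideal.mem_comap.mpr ?_
    exact e2.symm ▸ this
  exact h3 h2

section Ferrand

variable {Y Z : Scheme} (I : Y.IdealSheafData) (f : Z ⟶ Y)

theorem eq_of_conductor
    (hinj : ∀ U : Y.affineOpens, ∀ t ∈ I.ideal U, f.app U t = 0 → t = 0)
    {V : Y.Opens} {c d : Γ(Y, V)} (h1 : I.subschemeι.app V c = I.subschemeι.app V d)
    (h2 : f.app V c = f.app V d) : c = d := by
  refine section_ext_of_affineOpens fun U hU ↦ ?_
  rw [← sub_eq_zero]
  apply hinj U
  · rw [← IdealSheafData.ker_subschemeι_app, RingHom.mem_ker]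
    change I.subschemeι.app U _ = 0
    rw [map_sub, app_res, app_res, h1, sub_self]
  · rw [map_sub, app_res, app_res, h2, sub_self]

variable [IsAffineHom f]

theorem exists_section_of_conductor
    (hsurj : ∀ U : Y.affineOpens, ∀ s ∈ (I.ideal U).map (f.app U).hom,
      ∃ t ∈ I.ideal U, f.app U t = s)
    (hinj : ∀ U : Y.affineOpens, ∀ t ∈ I.ideal U, f.app U t = 0 → t = 0)
    (a : Γ(I.subscheme, ⊤)) (b : Γ(Z, ⊤))
    (h : (IdealSheafData.subschemeMap _ _ f (I.le_map_comap f)).appTop a =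
      (I.comap f).subschemeι.appTop b) :
    ∃ c : Γ(Y, ⊤), I.subschemeι.appTop c = a ∧ f.appTop c = b := by
  set i := I.subschemeι with hi
  set j := (I.comap f).subschemeι with hj
  set p := IdealSheafData.subschemeMap _ _ f (I.le_map_comap f) with hp
  have w : p ≫ i = j ≫ f := IdealSheafData.subschemeMap_subschemeι _ _ _ _
  have key (U : Y.affineOpens) : ∃ c : Γ(Y, U.1),
      i.app U c = I.subscheme.res le_top a ∧ f.app U c = Z.res le_top b := by
    obtain ⟨a', ha'⟩ := I.subschemeι_app_surjective U (I.subscheme.res le_top a)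
    have hk : f.app U a' - Z.res le_top b ∈ (I.comap f).ideal ⟨_, U.2.preimage f⟩ := by
      rw [← IdealSheafData.ker_subschemeι_app, RingHom.mem_ker]
      change j.app (f ⁻¹ᵁ U.1) _ = 0
      rw [map_sub, sub_eq_zero, app_res]
      have h1 : j.app (f ⁻¹ᵁ U.1) (f.app U a') = (j ≫ f).app U a' := by
        rw [Hom.comp_app]; rfl
      have h2 : (p ≫ i).app U a' = p.app (i ⁻¹ᵁ U.1) (i.app U a') := by
        rw [Hom.comp_app]; rfl
      replace ha' : i.app U a' = I.subscheme.res le_top a := ha'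
      rw [ha', app_res] at h2
      have h3 : (j ≫ f).app U a' = (I.comap f).subscheme.res (by rw [w]) ((p ≫ i).app U a') := by
        rw [Scheme.Hom.congr_app w.symm U]
        rfl
      rw [h1, h3, h2]
      change _ = (I.comap f).subscheme.res _ (j.appTop b)
      rw [← h]
      exact res_res _ _ (p.appTop a)
    obtain ⟨t, ht, hts⟩ := hsurj U _ (comap_ideal_le I f U hk)
    refine ⟨a' - t, ?_, ?_⟩
    · have : i.app U t = 0 := by
        rwa [← IdealSheafData.ker_subschemeι_app, RingHom.mem_ker] at ht
      rw [map_sub, this, sub_zero, hi, ha']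
    · rw [map_sub, hts, sub_sub_cancel]
  choose c hc1 hc2 using key
  obtain ⟨s, hs⟩ := exists_glue_affineOpens c fun U V hVU ↦ by
    refine eq_of_conductor I f hinj ?_ ?_
    · rw [app_res]
      change I.subscheme.res _ (i.app U (c U)) = i.app V (c V)
      rw [hc1, hc1, res_res]
    · rw [app_res, hc2, hc2, res_res]
  have hcov {W : Scheme} (g : W ⟶ Y) (x : W) (_ : x ∈ (⊤ : W.Opens)) :
      ∃ U : Y.affineOpens, x ∈ g ⁻¹ᵁ U.1 := by
    obtain ⟨U, hU, -⟩ := exists_affineOpens_le (V := ⊤) (x := g x) trivial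
    exact ⟨U, hU⟩
  refine ⟨s, section_ext _ (fun _ ↦ le_top) (hcov i) fun U ↦ ?_,
    section_ext _ (fun _ ↦ le_top) (hcov f) fun U ↦ ?_⟩
  · rw [← hc1, ← hs, app_res]
    rfl
  · rw [← hc2, ← hs, app_res]
    rfl

/-- Affineness descends along a conductor square. -/
theorem isAffine_of_conductor [IsAffine Z] [IsAffine I.subscheme]
    (hcov : ∀ y : Y, y ∉ I.support → y ∈ Set.range f)
    (hsurj : ∀ U : Y.affineOpens, ∀ s ∈ (I.ideal U).map (f.app U).hom,
      ∃ t ∈ I.ideal U, f.app U t = s)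
    (hinj : ∀ U : Y.affineOpens, ∀ t ∈ I.ideal U, f.app U t = 0 → t = 0) : IsAffine Y := by
  set T := I.subscheme with hT
  set i : T ⟶ Y := I.subschemeι with hi
  set j := (I.comap f).subschemeι with hj
  set p := IdealSheafData.subschemeMap _ _ f (I.le_map_comap f) with hp
  have w : p ≫ i = j ≫ f := IdealSheafData.subschemeMap_subschemeι _ _ _ _
  have wpt (e) : i (p e) = f (j e) := by
    rw [← Hom.comp_apply, ← Hom.comp_apply, w]
  have hcov' (y : Y) : y ∈ Set.range i ∨ y ∈ Set.range f := by
    by_cases hy : y ∈ I.support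
    · left; rw [hi, IdealSheafData.range_subschemeι]; exact hy
    · exact Or.inr (hcov y hy)
  have hE (z : Z) (hz : f z ∈ Set.range i) : z ∈ Set.range j := by
    rw [hj, IdealSheafData.range_subschemeι, IdealSheafData.support_comap]
    rw [hi, IdealSheafData.range_subschemeι] at hz
    exact hz
  have hglue := exists_section_of_conductor I f hsurj hinj
  have hext {c d : Γ(Y, ⊤)} := eq_of_conductor (c := c) (d := d) I f hinj
  have : IsAffine (I.comap f).subscheme := isAffine_of_isAffineHom j
  have hjs : Function.Surjective j.appTop := (IsClosedImmersion.isAffine_surjective_of_isAffine j).2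
  have his : Function.Surjective i.appTop := by
    intro a
    obtain ⟨b, hb⟩ := hjs (p.appTop a)
    obtain ⟨c, hc, -⟩ := hglue a b hb.symm
    exact ⟨c, hc⟩
  have hker (z : Z) (hz : z ∉ Set.range j) (V : Z.Opens) (hV : z ∈ V) :
      ∃ k, j.appTop k = 0 ∧ z ∈ Z.basicOpen k ∧ Z.basicOpen k ≤ V := by
    obtain ⟨g, hg, hgV⟩ := exists_mem_basicOpen_le (V := V ⊓ ⟨(Set.range j)ᶜ,
      j.isClosedEmbedding.isClosed_range.isOpen_compl⟩) (x := z) ⟨hV, hz⟩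
    have : IsNilpotent (j.appTop g) := by
      rw [isNilpotent_iff_basicOpen_eq_bot, eq_bot_iff]
      intro e he
      rw [mem_basicOpen_app] at he
      exact (hgV he).2 ⟨e, rfl⟩
    obtain ⟨n, hn⟩ := this
    have hle : Z.basicOpen (g ^ (n + 1)) = Z.basicOpen g := Z.basicOpen_pow _ n.succ_pos
    refine ⟨g ^ (n + 1), by rw [map_pow, pow_succ, hn, zero_mul], hle ▸ hg, ?_⟩
    rw [hle]
    exact hgV.trans inf_le_left
  have key (y : Y) : ∃ s : Γ(Y, ⊤), y ∈ Y.basicOpen s ∧ IsAffineOpen (Y.basicOpen s) := by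
    obtain ⟨U, hyU, -⟩ := exists_affineOpens_le (V := ⊤) (x := y) trivial
    suffices ∃ s : Γ(Y, ⊤), y ∈ Y.basicOpen s ∧ Y.basicOpen s ≤ U.1 from
      this.imp fun s h ↦ ⟨h.1, isAffineOpen_basicOpen_of_le U.2 h.2⟩
    by_cases hy : y ∈ Set.range i
    · obtain ⟨t, rfl⟩ := hy
      obtain ⟨a, hta, haU⟩ := exists_mem_basicOpen_le (V := i ⁻¹ᵁ U.1) (x := t) hyU
      obtain ⟨b, hb⟩ := hjs (p.appTop a)
      let 𝔴 : Ideal Γ(Z, ⊤) :=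
        { carrier := {g | Z.basicOpen g ≤ f ⁻¹ᵁ U.1}
          add_mem' := fun {x y} hx hy ↦ (basicOpen_add_le _ _ _).trans (sup_le hx hy)
          zero_mem' := by simp
          smul_mem' := fun c x hx ↦ by
            simp only [smul_eq_mul, Set.mem_ofPred_eq, Scheme.basicOpen_mul] at hx ⊢
            exact inf_le_right.trans hx }
      have hrad : b ∈ (RingHom.ker j.appTop.hom ⊔ 𝔴).radical := by
        rw [Ideal.radical_eq_sInf, Ideal.mem_sInf]
        rintro q ⟨hq, hqp⟩
        by_contra hbq
        obtain ⟨x, hx⟩ := exists_mem_basicOpen_iff_notMem q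
        have hxj : x ∈ Set.range j := by
          by_contra hxj
          obtain ⟨k, hk, hxk, -⟩ := hker x hxj ⊤ trivial
          exact (hx k).mp hxk (hq (Ideal.mem_sup_left hk))
        obtain ⟨e, rfl⟩ := hxj
        have h1 := (hx b).mpr hbq
        rw [← mem_basicOpen_app, hb, mem_basicOpen_app] at h1
        have h2 := haU h1
        have h3 : j e ∈ f ⁻¹ᵁ U.1 := by
          change f (j e) ∈ U.1
          rw [← wpt]; exact h2
        obtain ⟨g, hg, hgU⟩ := exists_mem_basicOpen_le h3
        exact (hx g).mp hg (hq (Ideal.mem_sup_right hgU))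
      obtain ⟨n, hn⟩ := hrad
      obtain ⟨k, hk, b', hb', hkb⟩ := Submodule.mem_sup.mp (Ideal.mul_mem_left _ b hn)
      obtain ⟨s, hs1, hs2⟩ := hglue (a ^ (n + 1)) b' (by
        have : j.appTop k = 0 := hk
        rw [map_pow, ← hb, ← map_pow, pow_succ', ← hkb, map_add, this, zero_add])
      refine ⟨s, ?_, ?_⟩
      · rw [← mem_basicOpen_app, hs1, T.basicOpen_pow _ n.succ_pos]
        exact hta
      · intro y hy
        rcases hcov' y with ⟨t', rfl⟩ | ⟨z, rfl⟩
        · rw [← mem_basicOpen_app, hs1, T.basicOpen_pow _ n.succ_pos] at hy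
          exact haU hy
        · rw [← mem_basicOpen_app, hs2] at hy
          exact hb' hy
    · obtain ⟨z, rfl⟩ := (hcov' y).resolve_left hy
      obtain ⟨k, hk, hzk, hkU⟩ := hker z (fun ⟨e, he⟩ ↦ hy ⟨p e, by rw [wpt, he]⟩) (f ⁻¹ᵁ U.1) hyU
      obtain ⟨s, hs1, hs2⟩ := hglue 0 k (by rw [map_zero, hk])
      refine ⟨s, ?_, ?_⟩
      · rw [← mem_basicOpen_app, hs2]; exact hzk
      · intro y hy
        rcases hcov' y with ⟨t', rfl⟩ | ⟨z, rfl⟩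
        · rw [← mem_basicOpen_app, hs1, basicOpen_zero] at hy
          exact hy.elim
        · rw [← mem_basicOpen_app, hs2] at hy
          exact hkU hy
  refine isAffine_of_isAffineOpen_basicOpen {s | IsAffineOpen (Y.basicOpen s)} ?_ fun _ h ↦ h
  set S : Set Γ(Y, ⊤) := {s | IsAffineOpen (Y.basicOpen s)} with hS
  have hmap {W : Scheme} [IsAffine W] (g : W ⟶ Y) : (Ideal.span S).map g.appTop.hom = ⊤ := by
    by_contra hne
    obtain ⟨m, hm, hle⟩ := Ideal.exists_le_maximal _ hne
    obtain ⟨x, hx⟩ := exists_mem_basicOpen_iff_notMem m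
    obtain ⟨s, hs, hsS⟩ := key (g x)
    rw [← mem_basicOpen_app] at hs
    exact (hx _).mp hs (hle (Ideal.mem_map_of_mem _ (Ideal.subset_span hsS)))
  obtain ⟨σ, hσ, hσ1⟩ : ∃ σ ∈ Ideal.span S, i.appTop σ = 1 := by
    have : (1 : Γ(T, ⊤)) ∈ (Ideal.span S).map i.appTop.hom := by rw [hmap]; trivial
    exact (Ideal.mem_map_iff_of_surjective _ his).mp this
  have hh : j.appTop (f.appTop (1 - σ)) = 0 := by
    have : j.appTop (f.appTop (1 - σ)) = p.appTop (i.appTop (1 - σ)) := by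
      rw [← CommRingCat.comp_apply, ← CommRingCat.comp_apply, ← Hom.comp_appTop, ← Hom.comp_appTop, w]
    rw [this, map_sub, hσ1, map_one, sub_self, map_zero]
  have hmul : ∀ x ∈ (Ideal.span S).map f.appTop.hom, ∀ b, ∃ s ∈ Ideal.span S, i.appTop s = 0 ∧
      f.appTop s = f.appTop (1 - σ) * b * x := by
    intro x hx
    refine Submodule.span_induction ?_ ?_ ?_ ?_ hx
    · rintro _ ⟨s, hs, rfl⟩ b
      obtain ⟨u, hu1, hu2⟩ := hglue 0 (f.appTop (1 - σ) * b) (by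
        rw [map_zero, map_mul, hh, zero_mul])
      exact ⟨u * s, Ideal.mul_mem_left _ _ hs, by rw [map_mul, hu1, zero_mul], by
        rw [map_mul, hu2]⟩
    · exact fun _ ↦ ⟨0, zero_mem _, map_zero _, by rw [map_zero, mul_zero]⟩
    · rintro x y - - hx hy b
      obtain ⟨s, hs, hs1, hs2⟩ := hx b
      obtain ⟨t, ht, ht1, ht2⟩ := hy b
      exact ⟨s + t, add_mem hs ht, by rw [map_add, hs1, ht1, add_zero], by
        rw [map_add, hs2, ht2, mul_add]⟩
    · rintro a x - hx b
      obtain ⟨s, hs, hs1, hs2⟩ := hx (b * a)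
      exact ⟨s, hs, hs1, by rw [hs2, smul_eq_mul, mul_assoc, mul_assoc, mul_assoc]⟩
  obtain ⟨s, hs, hs1, hs2⟩ := hmul 1 (by rw [hmap]; trivial) 1
  have : 1 - σ = s := hext (by
    change i.appTop _ = i.appTop _
    rw [map_sub, hσ1, map_one, sub_self, hs1]) (by
    change f.appTop _ = f.appTop _
    rw [hs2, mul_one, mul_one])
  rw [Ideal.eq_top_iff_one, ← sub_add_cancel 1 σ, this]
  exact add_mem hs hσ

end Ferrand

end AlgebraicGeometry.Scheme

theorem pow_eq_pow_of_pow_mul_sub_eq_zero {R : Type*} [CommRing R] {x y : R} {m : ℕ}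
    (hx : x ^ m * (x - y) = 0) (hy : y ^ m * (x - y) = 0) {n : ℕ} (hn : 2 * m < n) :
    x ^ n = y ^ n := by
  rw [← sub_eq_zero, ← (Commute.all x y).geom_sum₂_mul n, Finset.sum_mul]
  refine Finset.sum_eq_zero fun i hi ↦ ?_
  rw [Finset.mem_range] at hi
  rcases le_total m i with h | h
  · obtain ⟨k, rfl⟩ := Nat.exists_eq_add_of_le h
    rw [pow_add, mul_assoc, mul_right_comm, mul_assoc, mul_comm _ (x - y)]
    linear_combination (x ^ k * y ^ (n - 1 - (m + k))) * hx
  · obtain ⟨k, hk⟩ := Nat.exists_eq_add_of_le (show m ≤ n - 1 - i by omega)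
    rw [hk, pow_add]
    linear_combination (x ^ i * y ^ k) * hy

theorem IsLocalization.Away.exists_pow_lift {B B' : Type*} [CommRing B] [CommRing B']
    [Algebra B B'] (r : B) [IsLocalization.Away r B'] {ρ : B'}
    (h : IsNilpotent (ρ - algebraMap B B' r)) :
    ∃ N₀ : ℕ, ∀ N ≥ N₀, ∃ g : B, algebraMap B B' g = ρ ^ N ∧ IsNilpotent (g - r ^ N) := by
  set n := ρ - algebraMap B B' r with hn
  obtain ⟨e, he⟩ := h
  replace he : n ^ (e + 1) = 0 := by rw [pow_succ, he, zero_mul]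
  generalize he1 : e + 1 = e' at he
  obtain ⟨a, m₀, hm₀⟩ := IsLocalization.Away.surj r n
  have h1 : algebraMap B B' (m₀ ^ e') = 0 := by
    rw [map_pow, ← hm₀, mul_pow, he, zero_mul]
  obtain ⟨⟨_, b, rfl⟩, hb⟩ := (IsLocalization.map_eq_zero_iff (Submonoid.powers r) B' _).mp h1
  set m := r ^ b * m₀ with hm
  have hmn : IsNilpotent m := by
    refine ⟨e' + 1, ?_⟩
    rw [hm, mul_pow, pow_succ, pow_succ]
    linear_combination ((r ^ b) ^ e' * m₀ ) * hb
  have hm1 : algebraMap B B' m = algebraMap B B' r ^ (a + b) * n := by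
    rw [hm, map_mul, ← hm₀, map_pow]; ring
  refine ⟨(a + b + 1) * e', fun N hN ↦
    ⟨∑ k ∈ Finset.range e', m ^ k * r ^ (N - (a + b + 1) * k) * (N.choose k : B), ?_, ?_⟩⟩
  · have : ρ = n + algebraMap B B' r := by rw [hn]; ring
    rw [this, add_pow, map_sum]
    have hle : e' ≤ N + 1 := by nlinarith
    rw [← Finset.sum_subset (Finset.range_mono hle)]
    · refine Finset.sum_congr rfl fun k hk ↦ ?_
      rw [map_mul, map_mul, map_pow, map_pow, hm1, map_natCast, mul_pow, ← pow_mul]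
      have : N - k = (a + b) * k + (N - (a + b + 1) * k) := by
        have : (a + b + 1) * k ≤ N :=
          (Nat.mul_le_mul_left _ (Finset.mem_range.mp hk).le).trans hN
        have : (a + b + 1) * k = (a + b) * k + k := by ring
        omega
      rw [this, pow_add]; ring
    · intro k _ hk
      rw [Finset.mem_range, not_lt] at hk
      rw [pow_eq_zero_of_le hk he, zero_mul, zero_mul]
  · rw [← he1, Finset.sum_range_succ']
    simp only [pow_zero, one_mul, mul_zero, Nat.sub_zero, Nat.choose_zero_right, Nat.cast_one,
      mul_one, add_sub_cancel_right]
    refine (nilradical B).sum_mem fun k _ ↦ ?_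
    rw [pow_succ', mul_assoc, mul_assoc]
    exact Ideal.mul_mem_right _ _ hmn

namespace AlgebraicGeometry.Scheme

variable {Y₀ Y : Scheme} (i : Y₀ ⟶ Y)

theorem app_eq_zero_of_isNilpotent [IsReduced Y₀] {U : Y.Opens} {s : Γ(Y, U)} (hs : IsNilpotent s) :
    i.app U s = 0 := (hs.map (i.app U).hom).eq_zero

theorem isNilpotent_of_app_eq_zero [Surjective i] {U : Y.Opens} (hU : IsCompact U.1) {s : Γ(Y, U)}
    (hs : i.app U s = 0) : IsNilpotent s := by
  have h : Y.basicOpen s = ⊥ := by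
    rw [eq_bot_iff]
    intro y hy
    obtain ⟨z, rfl⟩ := i.surjective y
    have : z ∈ Y₀.basicOpen (i.app U s) := by
      rw [← preimage_basicOpen]; exact hy
    rw [hs, basicOpen_zero] at this
    exact this
  exact (isNilpotent_iff_basicOpen_eq_bot_of_isCompact hU s).mpr h

theorem exists_finite_affineOpens_cover (Y : Scheme) [CompactSpace Y] :
    ∃ (s : Set Y.affineOpens), Finite s ∧ ∀ y : Y, ∃ U : s, y ∈ U.1.1 := by
  obtain ⟨s, hs, h⟩ := isCompact_iff_finite_and_eq_biUnion_affineOpens (U := (⊤ : Y.Opens)).mp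
    isCompact_univ
  refine ⟨s, hs, fun y ↦ ?_⟩
  have : y ∈ (⊤ : Y.Opens) := trivial
  rw [h] at this
  simp only [TopologicalSpace.Opens.mem_iSup] at this
  obtain ⟨U, hU, hy⟩ := this
  exact ⟨⟨U, hU⟩, hy⟩

theorem apply_mem_basicOpen_iff {U : Y.Opens} {r : Γ(Y₀, ⊤)} {s : Γ(Y, U)}
    (h : i.app U s = Y₀.res le_top r) (z : Y₀) :
    i z ∈ Y.basicOpen s ↔ i z ∈ U ∧ z ∈ Y₀.basicOpen r := by
  have : z ∈ Y₀.basicOpen (i.app U s) ↔ i z ∈ Y.basicOpen s := by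
    rw [← preimage_basicOpen]; rfl
  rw [← this, h, basicOpen_res']
  rfl

variable [IsClosedImmersion i] [Surjective i] [IsReduced Y₀]

theorem exists_appTop_eq_pow [CompactSpace Y] [QuasiSeparatedSpace Y]
    (r : Γ(Y₀, ⊤)) {U : Y.Opens} (hU : IsAffineOpen U) (hr : ∀ z, i z ∈ U ↔ z ∈ Y₀.basicOpen r) :
    ∃ (N : ℕ) (G : Γ(Y, ⊤)), i.appTop G = r ^ (N + 1) := by
  have hsurj (U : Y.affineOpens) : Function.Surjective (i.app U) :=
    i.app_surjective _ U.2
  obtain ⟨s, _, hs⟩ := exists_finite_affineOpens_cover Y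
  obtain ⟨ρ, hρ⟩ := hsurj ⟨U, hU⟩ (Y₀.res le_top r)
  choose a ha using fun V : s ↦ hsurj V.1 (Y₀.res le_top r)
  have hle (V : s) : Y.basicOpen (a V) ≤ U := by
    intro y hy
    obtain ⟨z, rfl⟩ := i.surjective y
    exact (hr z).mpr ((apply_mem_basicOpen_iff i (ha V) z).mp hy).2
  have hpow (V : s) : ∃ N₀ : ℕ, ∀ N ≥ N₀, ∃ g : Γ(Y, V.1.1),
      Y.res (Y.basicOpen_le (a V)) g = Y.res (hle V) ρ ^ N ∧ IsNilpotent (g - a V ^ N) := by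
    let := (Y.res (Y.basicOpen_le (a V))).toAlgebra
    have : IsLocalization.Away (a V) Γ(Y, Y.basicOpen (a V)) := V.1.2.isLocalization_basicOpen _
    refine IsLocalization.Away.exists_pow_lift (a V) (ρ := Y.res (hle V) ρ) ?_
    refine isNilpotent_of_app_eq_zero i (V.1.2.basicOpen (a V)).isCompact ?_
    change i.app _ (Y.res _ _ - Y.res _ _) = 0
    rw [map_sub, app_res, app_res, hρ, ha, res_res, res_res, sub_self]
  choose N₀ hN₀ using hpow
  obtain ⟨N, hN⟩ := (Set.finite_range N₀).bddAbove
  choose g hg hgn using fun V ↦ hN₀ V (N + 1) ((hN ⟨V, rfl⟩).trans N.le_succ)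
  replace hgn (V : s) : i.app V.1.1 (g V) = Y₀.res le_top (r ^ (N + 1)) := by
    have := app_eq_zero_of_isNilpotent i (hgn V)
    rwa [map_sub, map_pow, ha, sub_eq_zero, ← map_pow] at this
  have hgb (V : s) : Y.basicOpen (g V) ≤ Y.basicOpen (a V) := by
    intro y hy
    obtain ⟨z, rfl⟩ := i.surjective y
    rw [apply_mem_basicOpen_iff i (hgn V), Y₀.basicOpen_pow _ N.succ_pos] at hy
    rwa [apply_mem_basicOpen_iff i (ha V)]
  have hm (V W : s) (T : Y.Opens) (hTV : T ≤ Y.basicOpen (a V)) (hTW : T ≤ Y.basicOpen (a W)) :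
      Y.res (hTV.trans (Y.basicOpen_le _)) (g V) = Y.res (hTW.trans (Y.basicOpen_le _)) (g W) := by
    have h1 := congr_arg (Y.res hTV) (hg V)
    have h2 := congr_arg (Y.res hTW) (hg W)
    rw [map_pow, res_res, res_res] at h1 h2
    rw [h1, h2]
  have hb (V W : s) (y : Y) (hV : y ∈ V.1.1) (hy : y ∈ Y.basicOpen (g W)) : y ∈ Y.basicOpen (a V) := by
    replace hy := hgb W hy
    obtain ⟨z, rfl⟩ := i.surjective y
    rw [apply_mem_basicOpen_iff i (ha _)] at hy ⊢
    exact ⟨hV, hy.2⟩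
  have hcomp (V W : s) : ∃ m : ℕ, ∀ n > 2 * m, Y.res (inf_le_left : V.1.1 ⊓ W.1.1 ≤ _) (g V ^ n) =
      Y.res inf_le_right (g W ^ n) := by
    have hc : IsCompact (V.1.1 ⊓ W.1.1 : Y.Opens).1 :=
      QuasiSeparatedSpace.inter_isCompact V.1.1.1 W.1.1.1 V.1.1.2 V.1.2.isCompact W.1.1.2 W.1.2.isCompact
    set x := Y.res (inf_le_left : V.1.1 ⊓ W.1.1 ≤ _) (g V)
    set y := Y.res (inf_le_right : V.1.1 ⊓ W.1.1 ≤ _) (g W)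
    obtain ⟨m, hm1⟩ := exists_pow_mul_eq_zero_of_res_basicOpen_eq_zero_of_isCompact Y hc
      (x - y) x (by
        change Y.res (Y.basicOpen_le x) (x - y) = 0
        rw [map_sub, sub_eq_zero, res_res, res_res]
        refine hm V W _ ?_ ?_
        · exact fun p hp ↦ by
            rw [basicOpen_res'] at hp
            exact hb _ V _ hp.1.1 hp.2
        · exact fun p hp ↦ by
            rw [basicOpen_res'] at hp
            exact hb _ V _ hp.1.2 hp.2)
    obtain ⟨m', hm1'⟩ := exists_pow_mul_eq_zero_of_res_basicOpen_eq_zero_of_isCompact Y hc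
      (x - y) y (by
        change Y.res (Y.basicOpen_le y) (x - y) = 0
        rw [map_sub, sub_eq_zero, res_res, res_res]
        refine hm V W _ ?_ ?_
        · exact fun p hp ↦ by
            rw [basicOpen_res'] at hp
            exact hb _ W _ hp.1.1 hp.2
        · exact fun p hp ↦ by
            rw [basicOpen_res'] at hp
            exact hb _ W _ hp.1.2 hp.2)
    refine ⟨m + m', fun n hn ↦ ?_⟩
    rw [map_pow, map_pow]
    refine pow_eq_pow_of_pow_mul_sub_eq_zero (m := m + m') ?_ ?_ hn
    · rw [pow_add, mul_right_comm, hm1, zero_mul]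
    · rw [pow_add, mul_assoc, hm1', mul_zero]
  choose m hm' using hcomp
  obtain ⟨M, hM⟩ := (Set.finite_range fun p : s × s ↦ m p.1 p.2).bddAbove
  obtain ⟨G, hG⟩ := exists_glue (fun V : s ↦ V.1.1) hs (fun V ↦ g V ^ (2 * M + 1)) fun V W ↦
    hm' V W _ (by have : m V W ≤ M := hM ⟨(V, W), rfl⟩; omega)
  refine ⟨(N + 1) * (2 * M) + N, G, section_ext (fun V : s ↦ i ⁻¹ᵁ V.1.1) (fun _ ↦ le_top)
    (fun x _ ↦ hs (i x)) fun V ↦ ?_⟩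
  have h1 := app_res i (le_top (a := V.1.1)) G
  rw [hG, map_pow, hgn, ← map_pow, ← pow_mul] at h1
  exact h1.symm.trans (by congr 1)

/-- A quasi-compact quasi-separated scheme which admits an affine reduced scheme as a surjective
closed subscheme is affine. -/
theorem isAffine_of_isClosedImmersion_of_surjective {Y₀ Y : Scheme} (i : Y₀ ⟶ Y)
    [IsClosedImmersion i] [Surjective i] [IsReduced Y₀] [CompactSpace Y] [QuasiSeparatedSpace Y]
    [IsAffine Y₀] : IsAffine Y := by
  let φ := i.appTop.hom
  let := φ.toAlgebra
  set S : Set Γ(Y, ⊤) := {s | IsAffineOpen (Y.basicOpen s)} with hS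
  let W : Set Γ(Y₀, ⊤) := {r | ∃ U : Y.affineOpens, ∀ z ∈ Y₀.basicOpen r, i z ∈ U.1}
  have hW {r} (hr : r ∈ W) : ∃ (N : ℕ) (G : Γ(Y, ⊤)), G ∈ S ∧ φ G = r ^ (N + 1) := by
    obtain ⟨U, hU⟩ := hr
    obtain ⟨a, ha⟩ := i.app_surjective _ U.2 (Y₀.res le_top r)
    have hb (z) : i z ∈ Y.basicOpen a ↔ z ∈ Y₀.basicOpen r := by
      rw [apply_mem_basicOpen_iff i ha]
      exact ⟨fun h ↦ h.2, fun h ↦ ⟨hU z h, h⟩⟩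
    obtain ⟨N, G, hG⟩ := exists_appTop_eq_pow i r (U.2.basicOpen a) hb
    refine ⟨N, G, ?_, hG⟩
    have : Y.basicOpen G = Y.basicOpen a := by
      ext y
      obtain ⟨z, rfl⟩ := i.surjective y
      change i z ∈ Y.basicOpen G ↔ i z ∈ Y.basicOpen a
      rw [hb, ← mem_basicOpen_app, hG, Y₀.basicOpen_pow _ N.succ_pos]
    change IsAffineOpen _
    rw [this]
    exact U.2.basicOpen a
  have key (z : Y₀) : ∃ r ∈ W, z ∈ Y₀.basicOpen r := by
    obtain ⟨U, hyU, -⟩ := exists_affineOpens_le (V := ⊤) (x := i z) trivial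
    obtain ⟨g, hg, hgU⟩ := exists_mem_basicOpen_le (V := i ⁻¹ᵁ U.1) (x := z) hyU
    exact ⟨g, ⟨U, fun z hz ↦ hgU hz⟩, hg⟩
  have hspan : Ideal.span W = ⊤ := by
    by_contra hne
    obtain ⟨m, hm, hle⟩ := Ideal.exists_le_maximal _ hne
    obtain ⟨x, hx⟩ := exists_mem_basicOpen_iff_notMem m
    obtain ⟨r, hr, hxr⟩ := key x
    exact (hx r).mp hxr (hle (Ideal.subset_span hr))
  have hint : φ.IsIntegral := by
    intro r
    have : r ∈ Ideal.span W := hspan ▸ trivial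
    suffices ∀ a, φ.IsIntegralElem (a * r) by simpa using this 1
    refine Submodule.span_induction ?_ ?_ ?_ ?_ this
    · rintro r ⟨U, hU⟩ a
      obtain ⟨N, G, -, hG⟩ := hW (r := a * r) ⟨U, fun z hz ↦ hU z (by
        rw [basicOpen_mul] at hz; exact hz.2)⟩
      exact IsIntegral.of_pow N.succ_pos (hG ▸ φ.isIntegralElem_map)
    · intro a
      rw [mul_zero]; exact φ.isIntegralElem_zero
    · intro x y _ _ hx hy a
      rw [mul_add]
      exact (hx a).add φ (hy a)
    · intro b x _ hx a
      rw [smul_eq_mul, ← mul_assoc]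
      exact hx _
  refine isAffine_of_isAffineOpen_basicOpen S ?_ fun _ h ↦ h
  by_contra hne
  obtain ⟨m, hm, hle⟩ := Ideal.exists_le_maximal _ hne
  have : Algebra.IsIntegral Γ(Y, ⊤) Γ(Y₀, ⊤) := ⟨hint⟩
  obtain ⟨q, -, hq, hqm⟩ := Ideal.exists_ideal_over_prime_of_isIntegral m (⊥ : Ideal Γ(Y₀, ⊤)) (by
    intro s hs
    obtain ⟨n, hn⟩ := isNilpotent_of_app_eq_zero i (U := ⊤) isCompact_univ (s := s) hs
    exact hm.isPrime.mem_of_pow_mem n (hn ▸ zero_mem _))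
  obtain ⟨x, hx⟩ := exists_mem_basicOpen_iff_notMem q
  obtain ⟨r, hr, hxr⟩ := key x
  obtain ⟨N, G, hGS, hG⟩ := hW hr
  have : G ∈ q.comap (algebraMap _ _) := hqm ▸ hle (Ideal.subset_span hGS)
  rw [Ideal.mem_comap] at this
  change φ G ∈ q at this
  rw [hG] at this
  exact (hx r).mp hxr (hq.mem_of_pow_mem _ this)

/-- If the intersection of a chain of closed subschemes is affine, then so is one of them. -/
theorem exists_isAffine_subscheme_of_isChain {Y : Scheme} [CompactSpace Y] [QuasiSeparatedSpace Y]
    {c : Set Y.IdealSheafData} (hc : IsChain (· ≤ ·) c) (hne : c.Nonempty)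
    [IsAffine (sSup c).subscheme] : ∃ I ∈ c, IsAffine I.subscheme := by
  let D : (c)ᵒᵖ ⥤ Scheme :=
    { obj I := I.unop.1.subscheme
      map f := IdealSheafData.inclusion (f.unop.le : _ ≤ _)
      map_id I := IdealSheafData.inclusion_id _
      map_comp f g := (IdealSheafData.inclusion_comp _ _).symm }
  let s : Limits.Cone D :=
    { pt := (sSup c).subscheme
      π := { app I := IdealSheafData.inclusion (le_sSup I.unop.2)
             naturality I J f := by
              change 𝟙 _ ≫ _ = IdealSheafData.inclusion _ ≫ IdealSheafData.inclusion _
              rw [Category.id_comp, IdealSheafData.inclusion_comp] } }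
  have : Nonempty c := hne.to_subtype
  have : IsDirectedOrder c := ⟨fun x y ↦ by
    rcases hc.total x.2 y.2 with h | h
    · exact ⟨y, h, le_rfl⟩
    · exact ⟨x, le_rfl, h⟩⟩
  have hι (I J : (c)ᵒᵖ) (t : Limits.Cone D) :
      t.π.app I ≫ I.unop.1.subschemeι = t.π.app J ≫ J.unop.1.subschemeι := by
    have aux (I J : (c)ᵒᵖ) (h : I.unop.1 ≤ J.unop.1) :
        t.π.app I ≫ I.unop.1.subschemeι = t.π.app J ≫ J.unop.1.subschemeι := by
      rw [← t.w (homOfLE (show I.unop ≤ J.unop from h)).op, Category.assoc]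
      congr 1
      exact IdealSheafData.inclusion_subschemeι h
    rcases hc.total I.unop.2 J.unop.2 with h | h
    · exact aux I J h
    · exact (aux J I h).symm
  let I₀ : (c)ᵒᵖ := .op ⟨hne.some, hne.some_mem⟩
  have hker (t : Limits.Cone D) : sSup c ≤ (t.π.app I₀ ≫ I₀.unop.1.subschemeι).ker :=
    sSup_le fun J hJ ↦ by
      rw [hι I₀ (.op ⟨J, hJ⟩)]
      exact J.ker_subschemeι.ge.trans (Hom.le_ker_comp _ _)
  have hs : Limits.IsLimit s :=
    { lift t := IsClosedImmersion.lift (sSup c).subschemeι (t.π.app I₀ ≫ I₀.unop.1.subschemeι)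
        (by rw [IdealSheafData.ker_subschemeι]; exact hker t)
      fac t J := by
        rw [← cancel_mono J.unop.1.subschemeι, Category.assoc]
        change _ ≫ IdealSheafData.inclusion _ ≫ _ = _
        rw [IdealSheafData.inclusion_subschemeι, IsClosedImmersion.lift_fac, hι]
      uniq t m hm := by
        rw [← cancel_mono (sSup c).subschemeι, IsClosedImmersion.lift_fac, ← hm, Category.assoc]
        congr 1
        exact (IdealSheafData.inclusion_subschemeι _).symm }
  have hcl (I J : Y.IdealSheafData) (h : I ≤ J) : IsClosedImmersion (IdealSheafData.inclusion h) :=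
    have : IsClosedImmersion (IdealSheafData.inclusion h ≫ I.subschemeι) := by
      rw [IdealSheafData.inclusion_subschemeι]; infer_instance
    .of_comp _ I.subschemeι
  have (I : (c)ᵒᵖ) : CompactSpace (D.obj I) := I.unop.1.subschemeι.isClosedEmbedding.compactSpace
  have (I : (c)ᵒᵖ) : QuasiSeparatedSpace (D.obj I) :=
    quasiSeparatedSpace_of_quasiSeparated I.unop.1.subschemeι
  have {I J : (c)ᵒᵖ} (f : I ⟶ J) : IsAffineHom (D.map f) := by
    have := hcl _ _ (f.unop.le : _ ≤ _)
    change IsAffineHom (IdealSheafData.inclusion _)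
    infer_instance
  have : IsAffine s.pt := ‹_›
  obtain ⟨I, hI⟩ := Scheme.exists_isAffine_of_isLimit D s hs
  exact ⟨I.unop.1, I.unop.2, hI⟩

theorem isAffine_of_isClosedImmersion_of_ker {Z₁ Z₂ Y : Scheme} (i₁ : Z₁ ⟶ Y) (i₂ : Z₂ ⟶ Y)
    [IsClosedImmersion i₁] [IsClosedImmersion i₂] (h : i₁.ker = i₂.ker) [IsAffine Z₂] :
    IsAffine Z₁ := by
  have := IsClosedImmersion.isIso_of_ker_eq i₁ i₂ (IsClosedImmersion.lift i₂ i₁ h.ge)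
    (IsClosedImmersion.lift_fac _ _ _) h
  exact .of_isIso (IsClosedImmersion.lift i₂ i₁ h.ge)

/-- A non-affine quasi-compact quasi-separated scheme contains a non-affine closed subscheme all
of whose proper closed subschemes are affine. -/
theorem exists_minimal_not_isAffine {Y : Scheme} [CompactSpace Y] [QuasiSeparatedSpace Y]
    (hY : ¬ IsAffine Y) : ∃ (Y' : Scheme) (i : Y' ⟶ Y), IsClosedImmersion i ∧ ¬ IsAffine Y' ∧
      ∀ J : Y'.IdealSheafData, J ≠ ⊥ → IsAffine J.subscheme := by
  obtain ⟨I, -, hI, hmax⟩ := zorn_le_nonempty₀ {I : Y.IdealSheafData | ¬ IsAffine I.subscheme}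
    (fun c hcs hc y hy ↦ ⟨sSup c, fun h ↦ by
      obtain ⟨I, hIc, hI⟩ := exists_isAffine_subscheme_of_isChain hc ⟨y, hy⟩
      exact hcs hIc hI, fun z ↦ le_sSup⟩) ⊥ (fun h ↦ hY (by
        have := (isIso_subschemeι_iff_eq_bot (I := (⊥ : Y.IdealSheafData))).mpr rfl
        exact .of_isIso (inv (⊥ : Y.IdealSheafData).subschemeι)))
  refine ⟨I.subscheme, I.subschemeι, inferInstance, hI, fun J hJ ↦ ?_⟩
  by_contra hJa
  set K := (J.subschemeι ≫ I.subschemeι).ker with hK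
  have hIK : I ≤ K := I.ker_subschemeι.ge.trans (Hom.le_ker_comp _ _)
  have hKa : ¬ IsAffine K.subscheme := fun h ↦ hJa <|
    isAffine_of_isClosedImmersion_of_ker (J.subschemeι ≫ I.subschemeι) K.subschemeι
      (by rw [IdealSheafData.ker_subschemeι])
  have hKI : K = I := (hmax hKa hIK).antisymm hIK
  apply hJ
  rw [← isIso_subschemeι_iff_eq_bot]
  exact IsClosedImmersion.isIso_of_ker_eq (J.subschemeι ≫ I.subschemeι) I.subschemeι J.subschemeι rfl
    (by rw [← hK, hKI, IdealSheafData.ker_subschemeι])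

/-- A scheme that is the union of two affine closed subschemes is affine. -/
theorem isAffine_of_inf_eq_bot {Y : Scheme} (I J : Y.IdealSheafData) (h : I ⊓ J = ⊥)
    [IsAffine I.subscheme] [IsAffine J.subscheme] : IsAffine Y := by
  refine isAffine_of_conductor I J.subschemeι (fun y hy ↦ ?_) (fun U s hs ↦ ?_) (fun U t ht h0 ↦ ?_)
  · rw [J.range_subschemeι]
    have h1 : (I * J).support = ⊤ := by
      have : I * J ≤ ⊥ := h ▸ fun U ↦ Ideal.mul_le_inf
      rw [le_bot_iff.mp this, IdealSheafData.support_bot]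
    rw [IdealSheafData.support_mul] at h1
    have h2 : y ∈ I.support ⊔ J.support := h1 ▸ trivial
    exact h2.resolve_left hy
  · exact (Ideal.mem_map_iff_of_surjective _ (J.subschemeι_app_surjective U)).mp hs
  · have h1 : t ∈ J.ideal U := by
      rw [← J.ker_subschemeι_app]; exact h0
    have h2 : t ∈ (I ⊓ J).ideal U := ⟨ht, h1⟩
    rwa [h] at h2

instance isReduced_subscheme_nilradical (Y : Scheme) : IsReduced Y.nilradical.subscheme := by
  have (U : Y.nilradical.subschemeCover.openCover.I₀) :
      IsReduced (Y.nilradical.subschemeCover.openCover.X U) := by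
    change Y.affineOpens at U
    have : _root_.IsReduced (Γ(Y, U) ⧸ Y.nilradical.ideal U) :=
      (Ideal.isRadical_iff_quotient_reduced _).mp (Ideal.radical_isRadical ⊥)
    change IsReduced (Spec (.of (Γ(Y, U) ⧸ Y.nilradical.ideal U)))
    infer_instance
  exact .of_openCover _ Y.nilradical.subschemeCover.openCover

/-- A non-affine scheme all of whose proper closed subschemes are affine is integral. -/
theorem isIntegral_of_not_isAffine {Y : Scheme} [CompactSpace Y] [QuasiSeparatedSpace Y]
    (hY : ¬ IsAffine Y) (hJ : ∀ J : Y.IdealSheafData, J ≠ ⊥ → IsAffine J.subscheme) :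
    IsIntegral Y := by
  have hred : IsReduced Y := by
    by_cases h : Y.nilradical = ⊥
    · have := (isIso_subschemeι_iff_eq_bot _).mpr h
      exact isReduced_of_isOpenImmersion (inv Y.nilradical.subschemeι)
    · have := hJ _ h
      have : Surjective Y.nilradical.subschemeι := ⟨by
        rw [← Set.range_eq_univ, IdealSheafData.range_subschemeι, support_nilradical]; rfl⟩
      exact absurd (isAffine_of_isClosedImmersion_of_surjective Y.nilradical.subschemeι) hY
  have hne : Nonempty Y := by
    by_contra h
    rw [not_nonempty_iff] at h
    exact hY inferInstance
  have : IrreducibleSpace Y := by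
    have : PreirreducibleSpace Y := ⟨by
      rw [isPreirreducible_iff_isClosed_union_isClosed]
      intro Z₁ Z₂ h1 h2 h
      by_contra! h'
      let K₁ : TopologicalSpace.Closeds Y := ⟨Z₁, h1⟩
      let K₂ : TopologicalSpace.Closeds Y := ⟨Z₂, h2⟩
      have hK (K : TopologicalSpace.Closeds Y) (hK : ¬ Set.univ ⊆ (K : Set Y)) :
          IsAffine (IdealSheafData.vanishingIdeal K).subscheme := by
        refine hJ _ fun h0 ↦ hK fun y _ ↦ ?_
        have : K ≥ (IdealSheafData.vanishingIdeal K).support :=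
          (IdealSheafData.coe_support_vanishingIdeal K).le
        rw [h0, IdealSheafData.support_bot] at this
        exact this trivial
      have := hK K₁ h'.1
      have := hK K₂ h'.2
      have hK : K₁ ⊔ K₂ = ⊤ := top_le_iff.mp fun y _ ↦ h trivial
      refine hY (isAffine_of_inf_eq_bot (.vanishingIdeal K₁) (.vanishingIdeal K₂) ?_)
      rw [← IdealSheafData.vanishingIdeal_sup, hK, IdealSheafData.vanishingIdeal_top,
        nilradical_eq_bot]⟩
    exact ⟨hne⟩
  exact isIntegral_of_irreducibleSpace_of_isReduced Y

end AlgebraicGeometry.Scheme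

/-- The conductor of a ring homomorphism `φ : A →+* B`: the elements `t` with `tB ⊆ φ(A)`. -/
def RingHom.conductorIdeal {A B : Type*} [CommRing A] [CommRing B] (φ : A →+* B) : Ideal A where
  carrier := {t | ∀ z, φ t * z ∈ φ.range}
  add_mem' h h' z := by rw [map_add, add_mul]; exact add_mem (h z) (h' z)
  zero_mem' z := by rw [map_zero, zero_mul]; exact zero_mem _
  smul_mem' a t h z := by
    rw [smul_eq_mul, map_mul, mul_assoc]; exact mul_mem ⟨a, rfl⟩ (h z)

namespace RingHom
variable {A B : Type*} [CommRing A] [CommRing B] {φ : A →+* B}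

/-- If `φ` is finite and elements of `B` can be multiplied into `φ(A)` by elements of a
submonoid `S`, then the conductor meets `S`. -/
theorem Finite.exists_mem_conductorIdeal (hφ : φ.Finite) (S : Submonoid A) (a : A)
    (h : ∀ z, ∃ s ∈ S, φ (s * a) * z ∈ φ.range) : ∃ s ∈ S, s * a ∈ φ.conductorIdeal := by
  algebraize [φ]
  obtain ⟨G, hG⟩ := (inferInstance : Module.Finite A B).fg_top
  choose s hs hsz using h
  refine ⟨∏ g ∈ G, s g, prod_mem fun g _ ↦ hs g, fun z ↦ ?_⟩
  have hz : z ∈ Submodule.span A (G : Set B) := hG ▸ trivial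
  induction hz using Submodule.span_induction with
  | mem g hg =>
    classical
    rw [← Finset.mul_prod_erase G s hg, mul_comm (s g), mul_assoc, map_mul, mul_assoc]
    exact mul_mem ⟨_, rfl⟩ (hsz g)
  | zero => rw [mul_zero]; exact zero_mem _
  | add x y _ _ hx hy => rw [mul_add]; exact add_mem hx hy
  | smul r x _ hx =>
    rw [Algebra.smul_def, mul_left_comm]
    exact mul_mem ⟨r, rfl⟩ hx

theorem map_conductorIdeal {A' B' : Type*} [CommRing A'] [CommRing B'] [Algebra A A']
    [Algebra B B'] {φ' : A' →+* B'} (g : A) [IsLocalization.Away g A']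
    [IsLocalization.Away (φ g) B'] (hφ : φ.Finite)
    (hc : ∀ a, φ' (algebraMap A A' a) = algebraMap B B' (φ a)) :
    φ.conductorIdeal.map (algebraMap A A') = φ'.conductorIdeal := by
  have hu (n : ℕ) : IsUnit (algebraMap A A' g ^ n) :=
    (IsLocalization.Away.algebraMap_isUnit (S := A') g).pow n
  apply le_antisymm
  · rw [Ideal.map_le_iff_le_comap]
    intro t ht z
    obtain ⟨n, w, hw⟩ := IsLocalization.Away.surj (φ g) z
    obtain ⟨c, hc'⟩ := ht w
    obtain ⟨u, hu'⟩ := hu n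
    refine ⟨↑u⁻¹ * algebraMap A A' c, ?_⟩
    have : φ' u * (φ' (algebraMap A A' t) * z) = φ' (algebraMap A A' c) := by
      rw [hc c, hc', map_mul, hc, hu', map_pow, hc, ← hw]; ring
    rw [map_mul, ← this, ← mul_assoc, ← map_mul, Units.inv_mul, map_one, one_mul]
  · intro t' ht'
    obtain ⟨n, t, ht⟩ := IsLocalization.Away.surj g t'
    obtain ⟨_, ⟨m, rfl⟩, hm⟩ := hφ.exists_mem_conductorIdeal (.powers g) t fun z ↦ by
      obtain ⟨c', hc'⟩ := ht' (algebraMap B B' z)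
      obtain ⟨k, c, hk⟩ := IsLocalization.Away.surj g c'
      have : algebraMap B B' (φ (g ^ k) * φ t * z) = algebraMap B B' (φ (g ^ n) * φ c) := by
        rw [map_mul, map_mul, map_mul, ← hc, ← hc, ← hc, ← hc, ← hk, ← ht]
        simp only [map_pow, map_mul]
        rw [hc']; ring
      obtain ⟨⟨_, l, rfl⟩, hl⟩ :=
        (IsLocalization.eq_iff_exists (Submonoid.powers (φ g)) B').mp this
      refine ⟨g ^ (l + k), ⟨_, rfl⟩, g ^ (l + n) * c, ?_⟩
      simp only [map_mul, map_pow, pow_add] at hl ⊢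
      linear_combination -hl
    have h1 := Ideal.mem_map_of_mem (algebraMap A A') hm
    rw [map_mul, ← ht, map_pow, mul_left_comm] at h1
    have h2 := (Ideal.unit_mul_mem_iff_mem _ (hu m)).mp (mul_left_comm t' _ _ ▸ h1)
    exact (Ideal.unit_mul_mem_iff_mem _ (hu n)).mp (mul_comm t' _ ▸ h2)

end RingHom

namespace AlgebraicGeometry.Scheme

/-- The conductor ideal sheaf of a finite morphism. -/
noncomputable def conductor {Z Y : Scheme} (f : Z ⟶ Y) [IsFinite f] : Y.IdealSheafData where
  ideal U := (f.app U).hom.conductorIdeal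
  map_ideal_basicOpen U g := by
    let := (Y.res (Y.basicOpen_le g)).toAlgebra
    have : IsLocalization.Away g Γ(Y, Y.basicOpen g) := U.2.isLocalization_basicOpen g
    have hle : f ⁻¹ᵁ Y.basicOpen g ≤ f ⁻¹ᵁ U.1 :=
      (TopologicalSpace.Opens.map f.base).monotone (Y.basicOpen_le g)
    let := (Z.res hle).toAlgebra
    have : IsLocalization.Away ((f.app U).hom g) Γ(Z, f ⁻¹ᵁ Y.basicOpen g) :=
      (U.2.preimage f).isLocalization_of_eq_basicOpen _ (homOfLE hle) (preimage_basicOpen f g)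
    exact RingHom.map_conductorIdeal (φ' := (f.app (Y.basicOpen g)).hom) g
      (f.finite_app _ U.2) fun a ↦ app_res f _ a

/-- Let `Y` be an integral scheme whose proper closed subschemes are affine. If there is a finite
birational morphism from an affine scheme onto `Y`, then `Y` is affine. -/
theorem isAffine_of_isFinite_of_birational {Z Y : Scheme} [IsIntegral Y] [IsAffine Z]
    (f : Z ⟶ Y) [IsFinite f] [Surjective f]
    (hinj : ∀ U : Y.affineOpens, Function.Injective (f.app U))
    (hbir : ∀ (U : Y.affineOpens) [Nonempty U.1] (z : Γ(Z, f ⁻¹ᵁ U)), ∃ d ≠ 0, ∃ c, f.app U d * z = f.app U c)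
    (hJ : ∀ J : Y.IdealSheafData, J ≠ ⊥ → IsAffine J.subscheme) : IsAffine Y := by
  have hne : conductor f ≠ ⊥ := by
    intro h0
    obtain ⟨y⟩ : Nonempty Y := inferInstance
    obtain ⟨U, hyU, -⟩ := exists_affineOpens_le (V := ⊤) (x := y) trivial
    have : Nonempty U.1 := ⟨⟨y, hyU⟩⟩
    obtain ⟨d, hd, hd'⟩ := (f.finite_app _ U.2).exists_mem_conductorIdeal
      (nonZeroDivisors Γ(Y, U.1)) 1 fun z ↦ by
        obtain ⟨d, hd, c, h⟩ := hbir U z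
        exact ⟨d, mem_nonZeroDivisors_of_ne_zero hd, c, by rw [mul_one]; exact h.symm⟩
    rw [mul_one] at hd'
    change d ∈ (conductor f).ideal U at hd'
    rw [h0] at hd'
    exact nonZeroDivisors.ne_zero hd hd'
  have := hJ _ hne
  refine isAffine_of_conductor (conductor f) f (fun y _ ↦ f.surjective y) (fun U s hs ↦ ?_)
    (fun U t _ h ↦ hinj U (h.trans (map_zero _).symm))
  induction hs using Submodule.span_induction with
  | mem x hx => exact hx
  | zero => exact ⟨0, zero_mem _, map_zero _⟩
  | add x y _ _ hx hy =>
    obtain ⟨a, ha, rfl⟩ := hx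
    obtain ⟨b, hb, rfl⟩ := hy
    exact ⟨a + b, add_mem ha hb, map_add _ _ _⟩
  | smul r x _ hx =>
    obtain ⟨a, ha, rfl⟩ := hx
    obtain ⟨c, hc⟩ := ha r
    refine ⟨c, fun z ↦ ?_, hc.trans (mul_comm _ _)⟩
    rw [hc, mul_assoc]
    exact ha _

end AlgebraicGeometry.Scheme

section GaloisDescent
variable {R K L : Type*} [CommRing R] [Field K] [Field L] [Algebra K L] [IsAlgClosure K L]

open Polynomial in
/-- Let `R` be a subring of an algebraic closure `L` of `K`, and `I` an ideal of `R` such that the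
conjugates of elements of `I` belong to `I`. Then elements of `I` satisfy monic equations with
coefficients in `I ∩ K`. -/
theorem exists_monic_of_forall_algEquiv (e : R →+* L) (he : Function.Injective e) (I : Ideal R)
    (hI : ∀ (σ : L ≃ₐ[K] L), ∀ b ∈ I, ∃ b' ∈ I, e b' = σ (e b)) {b : R} (hb : b ∈ I) :
    ∃ P : R[X], P.Monic ∧ P.eval b = 0 ∧ (∀ i, e (P.coeff i) ∈ (algebraMap K L).range) ∧
      ∀ i < P.natDegree, P.coeff i ∈ I := by
  have := IsAlgClosure.isAlgClosed K (K := L)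
  have := IsAlgClosure.isAlgebraic (R := K) (K := L)
  have : Normal K L := IsAlgClosure.normal K L
  have halg : IsAlgebraic K (e b) := Algebra.IsAlgebraic.isAlgebraic _
  set p := (minpoly K (e b)).map (algebraMap K L) with hp
  have hpm : p.Monic := (minpoly.monic halg.isIntegral).map _
  have ht (β : L) : ∃ t ∈ I, β ∈ p.roots → e t = β := by
    by_cases hβ : β ∈ p.roots
    · have h1 : aeval β (minpoly K (e b)) = 0 := by
        have := (mem_roots'.mp hβ).2
        rwa [hp, IsRoot, eval_map_algebraMap] at this
      obtain ⟨σ, rfl⟩ := minpoly.exists_algEquiv_of_root' halg h1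
      obtain ⟨b', hb', h⟩ := hI σ b hb
      exact ⟨b', hb', fun _ ↦ h⟩
    · exact ⟨0, zero_mem _, fun h ↦ absurd h hβ⟩
  choose t htI hte using ht
  set P : R[X] := (p.roots.map fun β ↦ X - C (t β)).prod with hP
  have hPm : P.Monic := monic_multiset_prod_of_monic _ _ fun β _ ↦ monic_X_sub_C _
  have hPp : P.map e = p := by
    refine Eq.trans ?_ ((IsAlgClosed.splits p).eq_prod_roots_of_monic hpm).symm
    rw [hP, Polynomial.map_multiset_prod, Multiset.map_map]
    congr 1
    exact Multiset.map_congr rfl fun β hβ ↦ by simp [hte β hβ]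
  refine ⟨P, hPm, he ?_, fun i ↦ ?_, fun i hi ↦ ?_⟩
  · rw [← eval_map_apply, hPp, map_zero, hp, eval_map_algebraMap, minpoly.aeval]
  · rw [← coeff_map, hPp, hp, coeff_map]
    exact ⟨_, rfl⟩
  · rw [← Ideal.Quotient.eq_zero_iff_mem, ← coeff_map, hP, Polynomial.map_multiset_prod,
      Multiset.map_map]
    have h1 : p.roots.map (Polynomial.map (Ideal.Quotient.mk I) ∘ fun β ↦ X - C (t β)) =
        p.roots.map fun _ ↦ X := Multiset.map_congr rfl fun β _ ↦ by
      simp [Ideal.Quotient.eq_zero_iff_mem.mpr (htI β)]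
    have h2 : i < p.roots.card := by
      refine hi.trans_le ?_
      rw [hP]
      refine (natDegree_multiset_prod_le _).trans ?_
      rw [Multiset.map_map]
      refine (Multiset.sum_le_card_nsmul _ 1 ?_).trans_eq (by simp)
      intro x hx
      obtain ⟨β, -, rfl⟩ := Multiset.mem_map.mp hx
      exact natDegree_X_sub_C_le _
    rw [h1, Multiset.map_const', Multiset.prod_replicate, coeff_X_pow, if_neg h2.ne]

open Polynomial in
theorem exists_finset_mul_eq_one_of_iSup_eq_top (e : R →+* L) (he : Function.Injective e)
    {Λ : Type*} (I : Λ → Ideal R)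
    (hI : ∀ (σ : L ≃ₐ[K] L) l, ∀ b ∈ I l, ∃ b' ∈ I l, e b' = σ (e b))
    (hσ : ∀ (σ : L ≃ₐ[K] L) b, ∃ b', e b' = σ (e b)) (htop : ⨆ l, I l = ⊤) :
    ∃ (s : Finset R) (c : R → R), (∀ a ∈ s, ∃ l, a ∈ I l) ∧
      (∀ a ∈ s, e a ∈ (algebraMap K L).range) ∧ (∀ a ∈ s, e (c a) ∈ (algebraMap K L).range) ∧
      ∑ a ∈ s, c a * a = 1 := by
  set A := (algebraMap K L).range.comap e with hA
  let S : Set A := {a | ∃ l, (a : R) ∈ I l}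
  have hint : A.subtype.IsIntegral := fun b ↦ by
    obtain ⟨P, hP, hPb, hPc, -⟩ := exists_monic_of_forall_algEquiv (K := K) e he ⊤
      (fun σ b _ ↦ (hσ σ b).imp fun _ h ↦ ⟨trivial, h⟩) (b := b) trivial
    have : P ∈ lifts A.subtype := (lifts_iff_coeff_lifts _).mpr fun n ↦ ⟨⟨_, hPc n⟩, rfl⟩
    obtain ⟨Q, rfl, -, hQ⟩ := lifts_and_natDegree_eq_and_monic this hP
    exact ⟨Q, hQ, by rwa [Polynomial.eval_map] at hPb⟩
  have hS : Ideal.span S = ⊤ := by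
    rw [← Ideal.map_eq_top_iff A.subtype Subtype.val_injective hint, ← Ideal.radical_eq_top,
      ← top_le_iff, ← htop, iSup_le_iff]
    intro l b hb
    obtain ⟨P, hP, hPb, hPc, hPI⟩ := exists_monic_of_forall_algEquiv (K := K) e he (I l)
      (fun σ ↦ hI σ l) hb
    refine ⟨P.natDegree, ?_⟩
    rw [eval_eq_sum_range, Finset.sum_range_succ, hP.coeff_natDegree, one_mul] at hPb
    rw [← neg_eq_of_add_eq_zero_right hPb]
    refine neg_mem (sum_mem fun i hi ↦ Ideal.mul_mem_right _ _ ?_)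
    exact Ideal.mem_map_of_mem A.subtype (x := (⟨P.coeff i, hPc i⟩ : A))
      (Ideal.subset_span ⟨l, hPI i (Finset.mem_range.mp hi)⟩)
  obtain ⟨s, hsS, hs⟩ := (Ideal.span_eq_top_iff_finite S).mp hS
  have h1 : (1 : A) ∈ Ideal.span (s : Set A) := hs ▸ trivial
  obtain ⟨c, hc⟩ := Submodule.mem_span_finset'.mp h1
  classical
  let c' : R → R := fun a ↦ if h : ∃ a' : s, (a' : R) = a then c h.choose else 0
  have hc' (a : s) : c' a = c a := by
    have h : ∃ a' : s, (a' : R) = a := ⟨a, rfl⟩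
    simp only [c', dif_pos h]
    congr 2
    exact Subtype.ext (Subtype.ext h.choose_spec)
  refine ⟨s.map (.subtype _), c', ?_, ?_, ?_, ?_⟩
  · intro a ha
    obtain ⟨a, ha', rfl⟩ := Finset.mem_map.mp ha
    exact hsS ha'
  · intro a ha
    obtain ⟨a, ha', rfl⟩ := Finset.mem_map.mp ha
    exact a.2
  · intro a ha
    obtain ⟨a, ha', rfl⟩ := Finset.mem_map.mp ha
    have := hc' ⟨a, ha'⟩
    change c' a = _ at this
    change e (c' a) ∈ _
    rw [this]
    exact (c _).2
  · rw [Finset.sum_map, ← Finset.sum_coe_sort s]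
    have := congr_arg A.subtype hc
    rw [map_sum, map_one] at this
    rw [← this]
    exact Finset.sum_congr rfl fun a _ ↦ by
      change c' a * a = _
      rw [hc']
      rfl

end GaloisDescent

namespace AlgebraicGeometry.Scheme

universe u

instance {X Y : Scheme.{u}} (f : X ⟶ Y) [QuasiCompact f] :
    IsSchemeTheoreticallyDominant f.toImage := by
  rw [isSchemeTheoreticallyDominant_iff]
  have hcov : ⨆ U : Y.affineOpens, (f.imageι ⁻¹ᵁ (U : Y.Opens)) = ⊤ := by
    rw [← Scheme.Hom.preimage_iSup, iSup_affineOpens_eq_top, Scheme.Hom.preimage_top]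
  refine IdealSheafData.ext_of_iSup_eq_top
    (fun U : Y.affineOpens ↦ ⟨f.imageι ⁻¹ᵁ U, U.2.preimage _⟩) hcov fun U ↦ ?_
  simpa [Hom.ker_apply] using (RingHom.injective_iff_ker_eq_bot _).mp (f.toImage_app_injective U)

theorem isReduced_image {X Y : Scheme.{u}} (f : X ⟶ Y) [QuasiCompact f] [IsReduced X] :
    IsReduced f.image :=
  IsSchemeTheoreticallyDominant.isReduced f.toImage

theorem isIntegral_image {X Y : Scheme.{u}} (f : X ⟶ Y) [QuasiCompact f] [IsIntegral X] :
    IsIntegral f.image := by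
  have := isReduced_image f
  have : IrreducibleSpace f.image := by
    have := f.toImage.denseRange
    have h : IsIrreducible (Set.range f.toImage) := by
      rw [← Set.image_univ]
      exact (IrreducibleSpace.isIrreducible_univ X).image _ f.toImage.continuous.continuousOn
    have := h.closure
    rw [f.toImage.denseRange.closure_eq] at this
    exact (irreducibleSpace_def _).mpr this
  exact isIntegral_of_irreducibleSpace_of_isReduced _

theorem exists_lift_image {W K N P : Scheme.{u}} (q : K ⟶ P) (i : W ⟶ N) (w : W ⟶ K) (n : N ⟶ P)
    [IsSchemeTheoreticallyDominant i] (h : w ≫ q = i ≫ n) :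
    ∃ g : N ⟶ q.image, g ≫ q.imageι = n ∧ i ≫ g = w ≫ q.toImage := by
  have hk : q.imageι.ker ≤ n.ker := by
    have h1 : q.imageι.ker = q.ker := IdealSheafData.ker_subschemeι _
    have h2 : (i ≫ n).ker = n.ker := by
      rw [Hom.ker_comp, i.ker_eq_bot, IdealSheafData.map_bot]
    rw [h1, ← h2, ← h]
    exact Hom.le_ker_comp _ _
  refine ⟨IsClosedImmersion.lift _ _ hk, IsClosedImmersion.lift_fac _ _ _, ?_⟩
  rw [← cancel_mono q.imageι, Category.assoc, Category.assoc, IsClosedImmersion.lift_fac,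
    Hom.toImage_imageι, h]

theorem iSup_ideal_eq_top_of_isAffine {N : Scheme.{u}} [IsAffine N] {Λ : Type*}
    (V : Λ → N.Opens) (hV : ∀ x, ∃ l, x ∈ V l) (I : Λ → Ideal Γ(N, ⊤))
    (hI : ∀ l a, N.basicOpen a ≤ V l → a ∈ I l) : ⨆ l, I l = ⊤ := by
  by_contra h
  obtain ⟨q, hq, hle⟩ := Ideal.exists_le_maximal _ h
  obtain ⟨x, hx⟩ := exists_mem_basicOpen_iff_notMem q
  obtain ⟨l, hl⟩ := hV x
  obtain ⟨g, hg, hgl⟩ := exists_mem_basicOpen_le hl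
  exact (hx g).mp hg (hle (Ideal.mem_iSup_of_mem l (hI l g hgl)))

/-- The ideal of functions whose nonvanishing locus is contained in `V`. -/
noncomputable def vanishingOff (N : Scheme.{u}) (V : N.Opens) : Ideal Γ(N, ⊤) where
  carrier := {a | N.basicOpen a ≤ V}
  add_mem' {a b} ha hb := (N.basicOpen_add_le a b).trans (sup_le ha hb)
  zero_mem' := by simp
  smul_mem' c a ha := by
    change N.basicOpen (c * a) ≤ V
    rw [N.basicOpen_mul]
    exact inf_le_right.trans ha

/-- Galois descent of affineness along an integral closure in an algebraic closure. -/
theorem isAffine_of_forall_algEquiv {Y N : Scheme.{u}} [IsIntegral Y]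
    {K L : Type u} [Field K] [Field L] [Algebra K L] [IsAlgClosure K L]
    (k : Spec (.of K) ⟶ Y) [IsDominant k] [QuasiCompact k]
    (hk : ∀ (U : Y.affineOpens) [Nonempty U.1] (z : Γ(Spec (.of K), k ⁻¹ᵁ U)),
      ∃ d ≠ 0, ∃ c, k.app U d * z = k.app U c)
    [IsAffine N] (i : Spec (.of L) ⟶ N) [IsSchemeTheoreticallyDominant i] [QuasiCompact i]
    (h : N ⟶ Y) [IsIntegralHom h] [Surjective h]
    (hik : i ≫ h = Spec.map (CommRingCat.ofHom (algebraMap K L)) ≫ k)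
    (hσ : ∀ σ : L ≃ₐ[K] L, ∃ s : N ⟶ N, s ≫ h = h ∧
      i ≫ s = Spec.map (CommRingCat.ofHom (σ : L →+* L)) ≫ i)
    (hJ : ∀ J : Y.IdealSheafData, J ≠ ⊥ → IsAffine J.subscheme) : IsAffine Y := by
  let e : Γ(N, ⊤) →+* L := (i.appTop ≫ (ΓSpecIso (.of L)).hom).hom
  have he : Function.Injective e :=
    (ΓSpecIso (.of L)).commRingCatIsoToRingEquiv.injective.comp (i.app_injective ⊤)
  have hes (σ : L ≃ₐ[K] L) : ∃ s : N ⟶ N, s ≫ h = h ∧ ∀ a, e (s.appTop a) = σ (e a) := by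
    obtain ⟨s, hs, his⟩ := hσ σ
    refine ⟨s, hs, fun a ↦ ?_⟩
    have h1 : s.appTop ≫ i.appTop ≫ (ΓSpecIso (.of L)).hom =
        i.appTop ≫ (ΓSpecIso (.of L)).hom ≫ CommRingCat.ofHom (σ : L →+* L) := by
      rw [← ΓSpecIso_naturality, ← Category.assoc, ← Category.assoc, ← Hom.comp_appTop, his,
        Hom.comp_appTop]
    exact ConcreteCategory.congr_hom h1 a
  obtain ⟨s, c, hsI, hsK, hcK, hsc⟩ := exists_finset_mul_eq_one_of_iSup_eq_top (K := K) e he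
    (fun U : Y.affineOpens ↦ N.vanishingOff (h ⁻¹ᵁ U))
    (fun σ U b hb ↦ by
      obtain ⟨s, hs, hse⟩ := hes σ
      refine ⟨s.appTop b, ?_, hse b⟩
      intro x hx
      rw [mem_basicOpen_app] at hx
      have := hb hx
      change h x ∈ U.1
      rw [← hs]
      exact this)
    (fun σ b ↦ by
      obtain ⟨s, hs, hse⟩ := hes σ
      exact ⟨_, hse b⟩)
    (iSup_ideal_eq_top_of_isAffine (fun U : Y.affineOpens ↦ h ⁻¹ᵁ (U : Y.Opens))
      (fun x ↦ by
        obtain ⟨U, hU, -⟩ := exists_affineOpens_le (V := ⊤) (x := h x) trivial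
        exact ⟨U, hU⟩) _ fun l a ↦ id)
  let v : s ⊕ s → Γ(N, ⊤) := Sum.elim (fun a ↦ a) (fun a ↦ c a)
  have hv (j : s ⊕ s) : ∃ y : Γ(Spec (.of K), ⊤),
      (Spec.map (CommRingCat.ofHom (algebraMap K L))).appTop y = i.appTop (v j) := by
    have : ∃ y, algebraMap K L y = e (v j) := by
      rcases j with j | j
      exacts [hsK j j.2, hcK j j.2]
    obtain ⟨y, hy⟩ := this
    refine ⟨(ΓSpecIso (.of K)).inv y, ?_⟩
    have h1 := ConcreteCategory.congr_hom
      (ΓSpecIso_inv_naturality (CommRingCat.ofHom (algebraMap K L))) y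
    refine h1.symm.trans ?_
    change (ΓSpecIso (.of L)).inv (algebraMap K L y) = _
    rw [hy]
    exact ConcreteCategory.congr_hom (ΓSpecIso (.of L)).hom_inv_id (i.appTop (v j))
  choose w hw using hv
  let q : Spec (.of K) ⟶ 𝔸(s ⊕ s; Y) := AffineSpace.homOfVector k w
  let n : N ⟶ 𝔸(s ⊕ s; Y) := AffineSpace.homOfVector h v
  have hqn : Spec.map (CommRingCat.ofHom (algebraMap K L)) ≫ q = i ≫ n := by
    rw [AffineSpace.comp_homOfVector, AffineSpace.comp_homOfVector, hik]
    congr 1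
    exact funext hw
  have hqk : q ≫ (𝔸(s ⊕ s; Y) ↘ Y) = k := AffineSpace.homOfVector_over _ _
  have : QuasiCompact (q ≫ (𝔸(s ⊕ s; Y) ↘ Y)) := hqk ▸ inferInstance
  have : QuasiCompact q := .of_comp q (𝔸(s ⊕ s; Y) ↘ Y)
  have : IsIntegral q.image := isIntegral_image q
  obtain ⟨g, hgn, hig⟩ := exists_lift_image q i _ n hqn
  let f : q.image ⟶ Y := q.imageι ≫ (𝔸(s ⊕ s; Y) ↘ Y)
  have hgf : g ≫ f = h := by
    rw [← Category.assoc, hgn]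
    exact AffineSpace.homOfVector_over _ _
  have hqf : q.toImage ≫ f = k := by
    rw [← Category.assoc, q.toImage_imageι, hqk]
  have : UniversallyClosed (g ≫ f) := hgf ▸ inferInstance
  have : UniversallyClosed g := .of_comp_of_isSeparated g f
  have : Surjective (Spec.map (CommRingCat.ofHom (algebraMap K L))) :=
    ⟨fun x ↦ ⟨default, Subsingleton.elim _ _⟩⟩
  have hg1 : IsDominant (i ≫ g) := hig ▸ inferInstance
  have hg1 : IsDominant g := .of_comp i g
  have hg2 : Surjective g := .of_universallyClosed_of_isDominant g
  have hf2 : Surjective (g ≫ f) := hgf ▸ inferInstance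
  have hf2 : Surjective f := .of_comp g f
  have : UniversallyClosed f := .of_comp_surjective g f
  have : IsIntegralHom f := IsIntegralHom.iff_universallyClosed_and_isAffineHom.mpr
    ⟨inferInstance, inferInstance⟩
  have hf1 : IsFinite f := (IsFinite.iff_isIntegralHom_and_locallyOfFiniteType f).mpr
    ⟨inferInstance, inferInstance⟩
  have : IsSchemeTheoreticallyDominant g := .of_isDominant g
  let y (j : s ⊕ s) : Γ(q.image, ⊤) := q.imageι.appTop (AffineSpace.coord Y j)
  have hy (j : s ⊕ s) : g.appTop (y j) = v j := by
    refine Eq.trans ?_ (AffineSpace.homOfVector_appTop_coord h v j)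
    change (q.imageι.appTop ≫ g.appTop) _ = _
    rw [← Hom.comp_appTop, hgn]
  have hf3 : IsAffine q.image := by
    refine isAffine_of_isAffineOpen_basicOpen (Set.range fun a ↦ y (.inl a)) ?_ ?_
    · have h1 : ∑ a, y (.inr a) * y (.inl a) = 1 := by
        apply g.app_injective ⊤
        rw [map_sum, map_one]
        refine Eq.trans ?_ ((Finset.sum_coe_sort s fun a ↦ c a * a).trans hsc)
        refine Finset.sum_congr rfl fun a _ ↦ ?_
        rw [map_mul]
        exact congr_arg₂ _ (hy _) (hy _)
      rw [Ideal.eq_top_iff_one, ← h1]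
      exact sum_mem fun a _ ↦ Ideal.mul_mem_left _ _ (Ideal.subset_span ⟨a, rfl⟩)
    · rintro _ ⟨a, rfl⟩
      obtain ⟨U, hU⟩ := hsI a a.2
      refine isAffineOpen_basicOpen_of_le (U.2.preimage f) fun x hx ↦ ?_
      obtain ⟨x, rfl⟩ := g.surjective x
      rw [← mem_basicOpen_app, hy] at hx
      change (g ≫ f) x ∈ U.1
      rw [hgf]
      exact hU hx
  refine isAffine_of_isFinite_of_birational f ?_ ?_ hJ
  · have : IsSchemeTheoreticallyDominant f := .of_isDominant f
    exact fun U ↦ f.app_injective _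
  · intro U _ z
    have hk' : ∀ (U : Y.affineOpens) [Nonempty U.1]
      (z : Γ(Spec (.of K), (q.toImage ≫ f) ⁻¹ᵁ U)), ∃ d ≠ 0, ∃ c,
        (q.toImage ≫ f).app U d * z = (q.toImage ≫ f).app U c := by
      rw [hqf]
      exact hk
    obtain ⟨d, hd, c, hc⟩ := hk' U (q.toImage.app _ z)
    refine ⟨d, hd, c, q.toImage.app_injective _ ?_⟩
    rw [map_mul]
    rw [Hom.comp_app] at hc
    exact hc

/-- The canonical morphism from the spectrum of a field extension of the function field. -/
noncomputable def fromFunctionField (Y : Scheme.{u}) [IsIntegral Y] (L : Type u) [Field L]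
    [Algebra Y.functionField L] : Spec (.of L) ⟶ Y :=
  Spec.map (CommRingCat.ofHom (algebraMap Y.functionField L)) ≫ Y.fromSpecStalk (genericPoint Y)

instance (Y : Scheme.{u}) [IsIntegral Y] : IsDominant (Y.fromSpecStalk (genericPoint Y)) := by
  refine ⟨?_⟩
  rw [denseRange_iff_closure_range, Y.range_fromSpecStalk, ← Set.univ_subset_iff,
    ← genericPoint_closure]
  exact closure_mono (Set.singleton_subset_iff.mpr specializes_rfl)

instance (Y : Scheme.{u}) [IsIntegral Y] (L : Type u) [Field L] [Algebra Y.functionField L] :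
    IsDominant (Y.fromFunctionField L) := by
  have : Surjective (Spec.map (CommRingCat.ofHom (algebraMap Y.functionField L))) := by
    have : Subsingleton (Spec Y.functionField) :=
      inferInstanceAs (Subsingleton (PrimeSpectrum Y.functionField))
    have : Nonempty (Spec (.of L)) := inferInstanceAs (Nonempty (PrimeSpectrum L))
    exact ⟨fun x ↦ ⟨Classical.arbitrary _, Subsingleton.elim _ _⟩⟩
  exact inferInstanceAs (IsDominant (_ ≫ _))

theorem exists_fromSpecStalk_app_eq (Y : Scheme.{u}) [IsIntegral Y] (U : Y.affineOpens)
    [Nonempty U.1] (z : Γ(Spec Y.functionField, Y.fromSpecStalk (genericPoint Y) ⁻¹ᵁ U)) :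
    ∃ d ≠ 0, ∃ c, (Y.fromSpecStalk (genericPoint Y)).app U d * z =
      (Y.fromSpecStalk (genericPoint Y)).app U c := by
  have hU : genericPoint Y ∈ U.1 :=
    ((genericPoint_spec Y).mem_open_set_iff U.1.isOpen).mpr (by simpa using ‹Nonempty U.1›)
  have := functionField_isFractionRing_of_isAffineOpen Y U.1 U.2
  have htop : (⊤ : (Spec Y.functionField).Opens) ≤ Y.fromSpecStalk (genericPoint Y) ⁻¹ᵁ U := by
    intro x _
    have h1 : Y.fromSpecStalk (genericPoint Y) x ⤳ genericPoint Y := by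
      have : Y.fromSpecStalk (genericPoint Y) x ∈ Set.range (Y.fromSpecStalk (genericPoint Y)) :=
        ⟨x, rfl⟩
      rwa [Y.range_fromSpecStalk] at this
    exact h1.mem_open U.1.isOpen hU
  let w : Y.functionField := (ΓSpecIso Y.functionField).hom (res _ htop z)
  obtain ⟨c, d, hd, h⟩ := IsFractionRing.div_surjective (A := Γ(Y, U)) w
  have hd0 := nonZeroDivisors.ne_zero hd
  have hz : z = res _ le_top ((ΓSpecIso Y.functionField).inv w) := by
    have h1 : (ΓSpecIso Y.functionField).inv w = res _ htop z :=
      ConcreteCategory.congr_hom (ΓSpecIso Y.functionField).hom_inv_id _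
    rw [h1, res_res, res_self]
  have happ (t : Γ(Y, U)) : (Y.fromSpecStalk (genericPoint Y)).app U t =
      res _ le_top ((ΓSpecIso Y.functionField).inv (algebraMap _ Y.functionField t)) :=
    ConcreteCategory.congr_hom (Y.fromSpecStalk_app hU) t
  refine ⟨d, hd0, c, ?_⟩
  rw [hz, happ, happ, ← map_mul, ← map_mul, ← h, mul_div_cancel₀]
  exact (map_ne_zero_iff _ (IsFractionRing.injective _ _)).mpr hd0

/-- If an integral `Y`-scheme through which the spectrum of an algebraic closure of the function
field factors is affine, and all proper closed subschemes of `Y` are affine, then so is `Y`. -/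
theorem isAffine_of_isIntegralHom_of_algebraicClosure {Y Z : Scheme.{u}} [IsIntegral Y]
    [Y.IsSeparated] (L : Type u) [Field L] [Algebra Y.functionField L]
    [IsAlgClosure Y.functionField L] [IsAffine Z] (j : Spec (.of L) ⟶ Z) (f : Z ⟶ Y)
    [IsIntegralHom f] (hjf : Y.fromFunctionField L = j ≫ f)
    (hJ : ∀ J : Y.IdealSheafData, J ≠ ⊥ → IsAffine J.subscheme) : IsAffine Y := by
  set p := Y.fromFunctionField L with hp
  have : IsAffine p.normalization := isAffine_of_isAffineHom (p.normalizationDesc j f hjf)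
  have : QuasiCompact (p.toNormalization ≫ p.fromNormalization) := by
    rw [p.toNormalization_fromNormalization]; infer_instance
  have : QuasiCompact p.toNormalization := .of_comp _ p.fromNormalization
  have : IsSchemeTheoreticallyDominant p.toNormalization := ⟨p.ker_toNormalization⟩
  have : IsDominant (p.toNormalization ≫ p.fromNormalization) := by
    rw [p.toNormalization_fromNormalization]; infer_instance
  have : IsDominant p.fromNormalization := .of_comp p.toNormalization _
  have : Surjective p.fromNormalization := .of_universallyClosed_of_isDominant _
  refine isAffine_of_forall_algEquiv (K := Y.functionField) (L := L)
    (Y.fromSpecStalk (genericPoint Y)) (exists_fromSpecStalk_app_eq Y)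
    p.toNormalization p.fromNormalization p.toNormalization_fromNormalization (fun σ ↦ ?_) hJ
  have hσ : p = (Spec.map (CommRingCat.ofHom (σ : L →+* L)) ≫ p.toNormalization) ≫
      p.fromNormalization := by
    rw [Category.assoc, p.toNormalization_fromNormalization]
    rw [hp, fromFunctionField, ← Category.assoc, ← Spec.map_comp, ← CommRingCat.ofHom_comp]
    congr 3
    ext x
    exact (σ.commutes x).symm
  exact ⟨p.normalizationDesc _ _ hσ, p.normalizationDesc_comp _ _ hσ,
    p.toNormalization_normalizationDesc _ _ hσ⟩

theorem appLE_surjective_of_eq {X Y : Scheme.{u}} (f : X ⟶ Y) {U : Y.Opens} {V : X.Opens}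
    (h : V = f ⁻¹ᵁ U) (hf : Function.Surjective (f.app U)) :
    Function.Surjective (f.appLE U V h.le) := by
  subst h
  rwa [← Hom.app_eq_appLE]

theorem appLE_injective_of_eq {X Y : Scheme.{u}} (f : X ⟶ Y) {U : Y.Opens} {V : X.Opens}
    (h : V = f ⁻¹ᵁ U) (hf : Function.Injective (f.app U)) :
    Function.Injective (f.appLE U V h.le) := by
  subst h
  rwa [← Hom.app_eq_appLE]

theorem affineSpace_closure_eq_top_of_isAffine {S : Scheme.{u}} [IsAffine S] (n : Type u) :
    Subring.closure (Set.range (𝔸(n; S) ↘ S).appTop ∪ Set.range (AffineSpace.coord S)) =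
      (⊤ : Subring Γ(𝔸(n; S), ⊤)) := by
  have : IsIso (AffineSpace.isoOfIsAffine n S).hom.appTop :=
    inferInstanceAs (IsIso ((AffineSpace.isoOfIsAffine n S).hom.app ⊤))
  have h1 : Function.Surjective (AffineSpace.isoOfIsAffine n S).hom.appTop :=
    (ConcreteCategory.bijective_of_isIso (AffineSpace.isoOfIsAffine n S).hom.appTop).2
  rw [AffineSpace.isoOfIsAffine_hom_appTop] at h1
  rw [eq_top_iff]
  rintro x -
  obtain ⟨y, rfl⟩ := h1 x
  change MvPolynomial.eval₂Hom _ _ ((ΓSpecIso _).hom y) ∈ _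
  generalize (ΓSpecIso _).hom y = P
  induction P using MvPolynomial.induction_on with
  | C a =>
    rw [MvPolynomial.coe_eval₂Hom, MvPolynomial.eval₂_C]
    exact Subring.subset_closure (.inl ⟨a, rfl⟩)
  | add p q hp hq => rw [map_add]; exact add_mem hp hq
  | mul_X p j hp =>
    rw [map_mul]
    refine mul_mem hp ?_
    rw [MvPolynomial.coe_eval₂Hom, MvPolynomial.eval₂_X]
    exact Subring.subset_closure (.inr ⟨j, rfl⟩)

theorem affineSpace_closure_eq_top {S : Scheme.{u}} (n : Type u) {V : S.Opens}
    (hV : IsAffineOpen V) :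
    Subring.closure (Set.range ((𝔸(n; S) ↘ S).app V) ∪
      Set.range fun j ↦ res _ le_top (AffineSpace.coord S j)) =
      (⊤ : Subring Γ(𝔸(n; S), (𝔸(n; S) ↘ S) ⁻¹ᵁ V)) := by
  have : IsAffine V := hV
  let m := AffineSpace.map n V.ι
  have hpb := AffineSpace.isPullback_map (n := n) V.ι
  have : IsOpenImmersion m := MorphismProperty.of_isPullback hpb.flip inferInstance
  have hm : m ≫ (𝔸(n; S) ↘ S) = (𝔸(n; V) ↘ (V : Scheme)) ≫ V.ι := AffineSpace.map_over V.ι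
  have hmV : (⊤ : Opens 𝔸(n; V)) = m ⁻¹ᵁ ((𝔸(n; S) ↘ S) ⁻¹ᵁ V) := by
    rw [← Hom.comp_preimage, hm, Hom.comp_preimage, V.ι_preimage_self, Hom.preimage_top]
  have hmV' : (𝔸(n; S) ↘ S) ⁻¹ᵁ V ≤ m.opensRange := by
    intro x hx
    obtain ⟨y, hy, -⟩ := exists_preimage_of_isPullback hpb x ⟨_, hx⟩ rfl
    exact ⟨y, hy⟩
  have hinj : Function.Injective (m.appLE _ _ hmV.le) := by
    refine appLE_injective_of_eq _ hmV ?_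
    have := m.isIso_app _ hmV'
    exact (ConcreteCategory.bijective_of_isIso (m.app _)).1
  rw [eq_top_iff]
  rintro x -
  have hx : m.appLE _ _ hmV.le x ∈ (⊤ : Subring Γ(𝔸(n; V), ⊤)) := trivial
  rw [← affineSpace_closure_eq_top_of_isAffine] at hx
  suffices h : m.appLE _ _ hmV.le x ∈ (Subring.closure (Set.range ((𝔸(n; S) ↘ S).app V) ∪
      Set.range fun j ↦ res _ le_top (AffineSpace.coord S j))).map (m.appLE _ _ hmV.le).hom by
    obtain ⟨y, hy, hyx⟩ := h
    exact hinj hyx ▸ hy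
  refine (Subring.closure_le.mpr ?_) hx
  rintro _ (⟨a, rfl⟩ | ⟨j, rfl⟩)
  · obtain ⟨a, rfl⟩ := (ConcreteCategory.bijective_of_isIso
      (V.ι.appLE V ⊤ V.ι_preimage_self.ge)).2 a
    refine ⟨_, Subring.subset_closure (.inl ⟨a, rfl⟩), ?_⟩
    change ((𝔸(n; S) ↘ S).app V ≫ m.appLE _ _ hmV.le) a =
      (V.ι.appLE V ⊤ V.ι_preimage_self.ge ≫ (𝔸(n; V) ↘ (V : Scheme)).app ⊤) a
    congr 2
    rw [Hom.app_eq_appLE, Hom.appLE_comp_appLE, Hom.app_eq_appLE, Hom.appLE_comp_appLE]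
    congr 1
  · refine ⟨_, Subring.subset_closure (.inr ⟨j, rfl⟩), ?_⟩
    refine Eq.trans ?_ (AffineSpace.map_appTop_coord (n := n) V.ι j)
    change ((𝔸(n; S)).presheaf.map _ ≫ m.appLE _ _ hmV.le) (AffineSpace.coord S j) = m.app ⊤ _
    rw [Hom.map_appLE, Hom.app_eq_appLE]
    rfl

theorem isAffineHom_of_isAffine_of_isSeparated {W Z : Scheme.{u}} [IsAffine W] [Z.IsSeparated]
    (m : W ⟶ Z) : IsAffineHom m :=
  have : IsAffineHom (m ≫ Limits.terminal.from Z) := inferInstance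
  .of_comp m (Limits.terminal.from Z)

theorem isSeparated_pullback_snd_terminal (Z W : Scheme.{u}) [Z.IsSeparated] :
    AlgebraicGeometry.IsSeparated
      (Limits.pullback.snd (Limits.terminal.from Z) (Limits.terminal.from W)) :=
  inferInstance

theorem isClosedImmersion_homOfVector_id {W Z : Scheme.{u}} [IsAffine W] [Z.IsSeparated]
    (m : W ⟶ Z) : IsClosedImmersion (AffineSpace.homOfVector m (id : Γ(W, ⊤) → Γ(W, ⊤))) := by
  set n := AffineSpace.homOfVector m (id : Γ(W, ⊤) → Γ(W, ⊤)) with hn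
  have h1 : IsClosedImmersion (n ≫ AffineSpace.toSpecMvPoly _ Z) := by
    refine .of_surjective_of_isAffine _ fun w ↦ ?_
    have h := AffineSpace.homOfVector_appTop_coord m (id : Γ(W, ⊤) → Γ(W, ⊤)) w
    rw [AffineSpace.coord, ← AffineSpace.toSpecMvPolyIntEquiv_comp] at h
    exact ⟨_, h⟩
  have h2 : IsSeparated (AffineSpace.toSpecMvPoly Γ(W, ⊤) Z) := by
    exact isSeparated_pullback_snd_terminal _ _
  exact .of_comp n (AffineSpace.toSpecMvPoly _ Z)

/-- The sections of an open of an affine `W` defined by `F` and pulled back from `V`. -/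
noncomputable def sectionsSubring {W Z : Scheme.{u}} (m : W ⟶ Z) (V : Z.Opens)
    (F : Set Γ(W, ⊤)) : Subring Γ(W, m ⁻¹ᵁ V) :=
  Subring.closure (Set.range (m.app V) ∪ res W le_top '' F)

theorem sectionsSubring_mono {W Z : Scheme.{u}} (m : W ⟶ Z) (V : Z.Opens)
    {F G : Set Γ(W, ⊤)} (h : F ⊆ G) : sectionsSubring m V F ≤ sectionsSubring m V G :=
  Subring.closure_mono (Set.union_subset_union_right _ (Set.image_mono h))

theorem exists_finset_mem_sectionsSubring {W Z : Scheme.{u}} (m : W ⟶ Z) (V : Z.Opens)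
    {g : Γ(W, m ⁻¹ᵁ V)} (hg : g ∈ sectionsSubring m V Set.univ) :
    ∃ F : Finset Γ(W, ⊤), g ∈ sectionsSubring m V F := by
  classical
  induction hg using Subring.closure_induction with
  | mem x hx =>
    rcases hx with hx | ⟨w, -, rfl⟩
    · exact ⟨∅, Subring.subset_closure (.inl hx)⟩
    · exact ⟨{w}, Subring.subset_closure (.inr ⟨w, by simp, rfl⟩)⟩
  | zero => exact ⟨∅, zero_mem _⟩
  | one => exact ⟨∅, one_mem _⟩
  | neg x _ hx => exact hx.imp fun _ h ↦ neg_mem h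
  | add x y _ _ hx hy =>
    obtain ⟨F, hF⟩ := hx
    obtain ⟨G, hG⟩ := hy
    exact ⟨F ∪ G, add_mem (sectionsSubring_mono m V (by simp) hF)
      (sectionsSubring_mono m V (by simp) hG)⟩
  | mul x y _ _ hx hy =>
    obtain ⟨F, hF⟩ := hx
    obtain ⟨G, hG⟩ := hy
    exact ⟨F ∪ G, mul_mem (sectionsSubring_mono m V (by simp) hF)
      (sectionsSubring_mono m V (by simp) hG)⟩

theorem range_homOfVector_appLE {W Z : Scheme.{u}} (m : W ⟶ Z) {V : Z.Opens}
    (hV : IsAffineOpen V) {n : Type u} (v : n → Γ(W, ⊤)) :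
    ∃ h : m ⁻¹ᵁ V = AffineSpace.homOfVector m v ⁻¹ᵁ ((𝔸(n; Z) ↘ Z) ⁻¹ᵁ V),
      ((AffineSpace.homOfVector m v).appLE _ _ h.le).hom.range =
        sectionsSubring m V (Set.range v) := by
  have h0 := AffineSpace.homOfVector_over m v
  have h : m ⁻¹ᵁ V = AffineSpace.homOfVector m v ⁻¹ᵁ ((𝔸(n; Z) ↘ Z) ⁻¹ᵁ V) := by
    rw [← Hom.comp_preimage, h0]
  refine ⟨h, ?_⟩
  set φ := (AffineSpace.homOfVector m v).appLE _ _ h.le with hφ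
  have e1 : φ.hom ∘ (𝔸(n; Z) ↘ Z).app V = m.app V := by
    funext t
    refine ConcreteCategory.congr_hom (f := (𝔸(n; Z) ↘ Z).app V ≫ φ) (g := m.app V) ?_ t
    rw [Hom.app_eq_appLE, Hom.appLE_comp_appLE, Hom.app_eq_appLE]
    congr 1
  have e2 : φ.hom ∘ (fun j ↦ res 𝔸(n; Z) le_top (AffineSpace.coord Z j)) =
      res W le_top ∘ v := by
    funext j
    change (𝔸(n; Z).presheaf.map _ ≫ φ) (AffineSpace.coord Z j) = res W le_top (v j)
    rw [hφ, Hom.map_appLE, ← AffineSpace.homOfVector_appTop_coord m v j]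
    rfl
  rw [RingHom.range_eq_map, ← affineSpace_closure_eq_top n hV, RingHom.map_closure,
    Set.image_union, ← Set.range_comp, ← Set.range_comp, sectionsSubring, ← Set.range_comp,
    e1, e2]

theorem sectionsSubring_univ {W Z : Scheme.{u}} [IsAffine W] [Z.IsSeparated]
    (m : W ⟶ Z) {V : Z.Opens} (hV : IsAffineOpen V) : sectionsSubring m V Set.univ = ⊤ := by
  have := isClosedImmersion_homOfVector_id m
  have := isAffineHom_of_isAffine_of_isSeparated m
  obtain ⟨h, hr⟩ := range_homOfVector_appLE m hV (id : Γ(W, ⊤) → Γ(W, ⊤))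
  rw [Set.range_id] at hr
  rw [← hr, RingHom.range_eq_top]
  exact appLE_surjective_of_eq _ h (Hom.app_surjective _ _ (hV.preimage _))

theorem exists_finset_sectionsSubring_eq_top {W Z : Scheme.{u}} [IsAffine W] [Z.IsSeparated]
    (m : W ⟶ Z) [LocallyOfFiniteType m] {V : Z.Opens} (hV : IsAffineOpen V) :
    ∃ F : Finset Γ(W, ⊤), sectionsSubring m V F = ⊤ := by
  classical
  have := isAffineHom_of_isAffine_of_isSeparated m
  have hft := m.finiteType_appLE hV (hV.preimage m) le_rfl
  rw [← Hom.app_eq_appLE] at hft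
  algebraize [(m.app V).hom]
  obtain ⟨G, hG⟩ := Algebra.FiniteType.out (R := Γ(Z, V)) (A := Γ(W, m ⁻¹ᵁ V))
  have (g : Γ(W, m ⁻¹ᵁ V)) : ∃ F : Finset Γ(W, ⊤), g ∈ sectionsSubring m V F :=
    exists_finset_mem_sectionsSubring m V ((sectionsSubring_univ m hV).symm ▸ trivial)
  choose F hF using this
  refine ⟨G.biUnion F, eq_top_iff.mpr fun x _ ↦ ?_⟩
  have hx : x ∈ Algebra.adjoin Γ(Z, V) (G : Set Γ(W, m ⁻¹ᵁ V)) := hG ▸ trivial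
  refine Algebra.adjoin_induction (fun g hg ↦ ?_) (fun r ↦ ?_) (fun _ _ _ _ ↦ add_mem)
    (fun _ _ _ _ ↦ mul_mem) hx
  · exact sectionsSubring_mono m V (by exact_mod_cast Finset.subset_biUnion_of_mem F hg) (hF g)
  · exact Subring.subset_closure (.inl ⟨r, rfl⟩)

theorem morphismRestrict_appTop_surjective {W Z : Scheme.{u}} (f : W ⟶ Z) {U : Z.Opens}
    {V : W.Opens} (h : V = f ⁻¹ᵁ U) (hf : Function.Surjective (f.appLE U V h.le)) :
    Function.Surjective (f ∣_ U).appTop := by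
  subst h
  rw [← Hom.app_eq_appLE] at hf
  rw [morphismRestrict_appTop]
  have aux {U' : Z.Opens} (e : U' = U) : Function.Surjective (f.app U') := by
    subst e
    exact hf
  change Function.Surjective (_ ∘ f.app (U.ι ''ᵁ ⊤))
  exact (ConcreteCategory.bijective_of_isIso
    (W.presheaf.map (eqToHom (image_morphismRestrict_preimage f U ⊤)).op)).2.comp
    (aux U.ι_image_top)

/-- A morphism of finite type from an affine scheme to a separated scheme factors as a closed
immersion into a finite-dimensional affine space. -/
theorem exists_isClosedImmersion_homOfVector {W Z : Scheme.{u}} [IsAffine W] [Z.IsSeparated]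
    [CompactSpace Z] (m : W ⟶ Z) [LocallyOfFiniteType m] :
    ∃ F : Finset Γ(W, ⊤),
      IsClosedImmersion (AffineSpace.homOfVector m (fun a : F ↦ (a : Γ(W, ⊤)))) := by
  classical
  have := isAffineHom_of_isAffine_of_isSeparated m
  obtain ⟨s, hs, hcov⟩ := exists_finite_affineOpens_cover Z
  have (V : Z.affineOpens) := exists_finset_sectionsSubring_eq_top m V.2
  choose F hF using this
  have := Fintype.ofFinite s
  let G : Finset Γ(W, ⊤) := Finset.univ.biUnion fun V : s ↦ F V.1
  refine ⟨G, ?_⟩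
  set n := AffineSpace.homOfVector m (fun a : G ↦ (a : Γ(W, ⊤))) with hn
  have hsup : ⨆ V : s, (𝔸(G; Z) ↘ Z) ⁻¹ᵁ V.1.1 = ⊤ := by
    refine top_le_iff.mp fun x _ ↦ ?_
    obtain ⟨V, hV⟩ := hcov ((𝔸(G; Z) ↘ Z) x)
    exact TopologicalSpace.Opens.mem_iSup.mpr ⟨V, hV⟩
  refine (IsZariskiLocalAtTarget.iff_of_iSup_eq_top (P := @IsClosedImmersion) _ hsup).mpr
    fun V ↦ ?_
  have hn0 : n ≫ (𝔸(G; Z) ↘ Z) = m := AffineSpace.homOfVector_over m _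
  have hV := V.1.2.preimage (𝔸(G; Z) ↘ Z)
  obtain ⟨h, hr⟩ := range_homOfVector_appLE m V.1.2 (fun a : G ↦ (a : Γ(W, ⊤)))
  have htop : (⊤ : Subring _) ≤ sectionsSubring m V.1.1 (Set.range fun a : G ↦ (a : Γ(W, ⊤))) := by
    rw [← hF V.1]
    refine sectionsSubring_mono m _ fun a ha ↦ ⟨⟨a, ?_⟩, rfl⟩
    exact Finset.mem_biUnion.mpr ⟨V, Finset.mem_univ _, ha⟩
  rw [top_le_iff.mp htop, RingHom.range_eq_top] at hr
  have : IsAffine ((𝔸(G; Z) ↘ Z) ⁻¹ᵁ V.1.1) := hV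
  have : IsAffine (n ⁻¹ᵁ ((𝔸(G; Z) ↘ Z) ⁻¹ᵁ V.1.1)) := by
    rw [← Hom.comp_preimage, hn0]
    exact V.1.2.preimage m
  exact .of_surjective_of_isAffine _ (morphismRestrict_appTop_surjective n h hr)

end AlgebraicGeometry.Scheme

namespace Algebra

theorem quasiFiniteAt_of_forall_comap_eq {R S : Type*} [CommRing R] [CommRing S] [Algebra R S]
    [Algebra.FiniteType R S] (q : PrimeSpectrum S)
    (H : ∀ x y : PrimeSpectrum S, x ≤ y → x.comap (algebraMap R S) = q.comap (algebraMap R S) →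
      y.comap (algebraMap R S) = q.comap (algebraMap R S) → x = y) :
    Algebra.QuasiFiniteAt R q.asIdeal := by
  refine .of_isOpen_singleton_fiber q ?_
  set p := q.comap (algebraMap R S)
  let e := PrimeSpectrum.preimageHomeomorphFiber R S p
  have : IsNoetherianRing (p.asIdeal.Fiber S) :=
    Algebra.FiniteType.isNoetherianRing p.asIdeal.ResidueField _
  have h0 (x y : PrimeSpectrum (p.asIdeal.Fiber S)) (hxy : x ≤ y) : x = y := by
    refine e.symm.injective (Subtype.ext (H _ _ ?_ (e.symm x).2 (e.symm y).2))
    rw [PrimeSpectrum.le_iff_specializes] at hxy ⊢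
    exact (hxy.map e.symm.continuous).map continuous_subtype_val
  have : Ring.KrullDimLE 0 (p.asIdeal.Fiber S) := .mk₀ fun I hI ↦ by
    obtain ⟨M, hM, hIM⟩ := I.exists_le_maximal hI.ne_top
    rwa [show I = M from congr(($(h0 ⟨I, hI⟩ ⟨M, hM.isPrime⟩ hIM)).asIdeal)]
  have : IsArtinianRing (p.asIdeal.Fiber S) :=
    isArtinianRing_iff_isNoetherianRing_krullDimLE_zero.mpr ⟨inferInstance, inferInstance⟩
  rw [← e.isOpen_image]
  exact isOpen_discrete _

theorem exists_isIntegral_pow_mul {R S T : Type*} [CommRing R] [CommRing S] [CommRing T]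
    [Algebra R S] [Algebra T S] [Nontrivial S] {r : S} (hr : IsIntegral R r)
    (hT : ∀ t : T, ∃ n : ℕ, IsIntegral R (r ^ n * algebraMap T S t)) {x : S}
    (hx : IsIntegral T x) : ∃ n : ℕ, IsIntegral R (r ^ n * x) := by
  obtain ⟨p, hp, hpx⟩ := hx
  choose m hm using hT
  let N := p.support.sup (m ∘ p.coeff)
  have hN (i : ℕ) : IsIntegral R (r ^ N * algebraMap T S (p.coeff i)) := by
    by_cases hi : i ∈ p.support
    · obtain ⟨k, hk⟩ := Nat.exists_eq_add_of_le (Finset.le_sup (f := m ∘ p.coeff) hi)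
      rw [show N = m (p.coeff i) + k from hk, pow_add, mul_right_comm]
      exact (hm _).mul (hr.pow k)
    · rw [Polynomial.notMem_support_iff.mp hi, map_zero, mul_zero]
      exact isIntegral_zero
  have hp' := hp.map (algebraMap T S)
  refine ⟨N, .of_aeval_monic_of_isIntegral_coeff
    (p := (p.map (algebraMap T S)).scaleRoots (r ^ N))
    ((Polynomial.monic_scaleRoots_iff _).mpr hp') (fun h0 ↦ ?_) ?_ fun i ↦ ?_⟩
  · rw [Polynomial.natDegree_scaleRoots, hp.natDegree_map] at h0
    rw [(hp.natDegree_eq_zero).mp h0, Polynomial.eval₂_one] at hpx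
    exact one_ne_zero hpx
  · rw [Polynomial.scaleRoots_eval_mul, Polynomial.eval_map, hpx, mul_zero]
    exact isIntegral_zero
  · rw [Polynomial.coeff_scaleRoots, Polynomial.coeff_map]
    obtain hi | hi := lt_or_ge i (p.map (algebraMap T S)).natDegree
    · obtain ⟨k, hk⟩ := Nat.exists_eq_add_of_lt hi
      rw [show (p.map (algebraMap T S)).natDegree - i = k + 1 by lia, pow_succ', ← mul_assoc,
        mul_comm (algebraMap T S _)]
      exact (hN i).mul ((hr.pow N).pow k)
    · rw [Nat.sub_eq_zero_of_le hi, pow_zero, mul_one]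
      obtain rfl | hi := hi.eq_or_lt
      · rw [← Polynomial.coeff_map, ← Polynomial.leadingCoeff, hp'.leadingCoeff]
        exact isIntegral_one
      · rw [← Polynomial.coeff_map, Polynomial.coeff_eq_zero_of_natDegree_lt hi]
        exact isIntegral_zero

/-- A consequence of Zariski's main theorem for algebras which are only essentially integral
over an algebra of finite type. -/
theorem exists_notMem_forall_pow_mul_mem {R S : Type*} [CommRing R] [CommRing S] [Algebra R S]
    {s : Set S} (hs : s.Finite) (hint : ∀ x : S, IsIntegral (Algebra.adjoin R s) x)
    (hR : ∀ x : S, IsIntegral R x → x ∈ (algebraMap R S).range) (q : PrimeSpectrum S)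
    (H : ∀ x y : PrimeSpectrum S, x ≤ y → x.comap (algebraMap R S) = q.comap (algebraMap R S) →
      y.comap (algebraMap R S) = q.comap (algebraMap R S) → x = y) :
    ∃ r : R, algebraMap R S r ∉ q.asIdeal ∧
      ∀ x : S, ∃ n : ℕ, algebraMap R S r ^ n * x ∈ (algebraMap R S).range := by
  set T := Algebra.adjoin R s
  have : Algebra.IsIntegral T S := ⟨hint⟩
  have : Algebra.FiniteType R T := (Subalgebra.fg_iff_finiteType _).mp
    (Subalgebra.fg_def.mpr ⟨s, hs, rfl⟩)
  have hcomap (x : PrimeSpectrum S) : (x.comap (algebraMap T S)).comap (algebraMap R T) =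
      x.comap (algebraMap R S) := rfl
  set q' := q.comap (algebraMap T S)
  have : Algebra.QuasiFiniteAt R q'.asIdeal := by
    refine quasiFiniteAt_of_forall_comap_eq q' fun x y hxy hx hy ↦ ?_
    obtain ⟨P, hP, hPx⟩ := Ideal.exists_ideal_over_prime_of_isIntegral (S := S) x.asIdeal ⊥ (by
      rw [← RingHom.ker_eq_comap_bot, (RingHom.injective_iff_ker_eq_bot _).mp
        (Subtype.val_injective : Function.Injective (algebraMap T S))]
      exact bot_le)
    obtain ⟨Q, hPQ, hQ, hQy⟩ := Ideal.exists_ideal_over_prime_of_isIntegral y.asIdeal P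
      (hPx.2.le.trans hxy)
    have hx' : PrimeSpectrum.comap (algebraMap T S) ⟨P, hPx.1⟩ = x :=
      PrimeSpectrum.ext hPx.2
    have hy' : PrimeSpectrum.comap (algebraMap T S) ⟨Q, hQ⟩ = y :=
      PrimeSpectrum.ext hQy
    rw [← hx', ← hy']
    rw [← hx'] at hx
    rw [← hy'] at hy
    exact congrArg _ (H ⟨P, hPx.1⟩ ⟨Q, hQ⟩ hPQ hx hy)
  obtain ⟨r, hr, hrint, hrx⟩ := zariskisMainProperty_iff.mp
    (ZariskisMainProperty.of_finiteType (R := R) q'.asIdeal)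
  have aux (x : T) (hx : IsIntegral R x) : ∃ t : R, algebraMap R S t = x :=
    hR _ (hx.map T.val)
  obtain ⟨b, hb⟩ := aux r hrint
  refine ⟨b, hb ▸ hr, fun x ↦ ?_⟩
  have : Nontrivial S := q.nontrivial
  suffices ∃ n : ℕ, IsIntegral R ((r : S) ^ n * x) from this.imp fun n hn ↦ hb ▸ hR _ hn
  refine exists_isIntegral_pow_mul (r := (r : S)) (hrint.map T.val) (fun t : T ↦ ?_) (hint x)
  obtain ⟨m, hm⟩ := hrx t
  exact ⟨m, hm.map T.val⟩

end Algebra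

namespace AlgebraicGeometry.Scheme

universe u

theorem exists_finset_isIntegralElem_of_universallyClosed {W Z X : Scheme.{u}} [IsAffine W]
    [IsAffine X] [Z.IsSeparated] [CompactSpace Z] (m : W ⟶ Z) [LocallyOfFiniteType m]
    (h : Z ⟶ X) [UniversallyClosed h] :
    ∃ F : Finset Γ(W, ⊤), ∀ s : Γ(W, ⊤),
      (Subring.closure (Set.range (m ≫ h).appTop ∪ F)).subtype.IsIntegralElem s := by
  obtain ⟨F, hF⟩ := exists_isClosedImmersion_homOfVector m
  refine ⟨F, fun s ↦ ?_⟩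
  set c := AffineSpace.homOfVector (m ≫ h) (fun a : F ↦ (a : Γ(W, ⊤))) with hc
  have hm : AffineSpace.homOfVector m (fun a : F ↦ (a : Γ(W, ⊤))) ≫ AffineSpace.map F h = c := by
    refine AffineSpace.hom_ext ?_ fun i ↦ ?_
    · rw [Category.assoc, AffineSpace.map_over, ← Category.assoc, AffineSpace.homOfVector_over,
        hc, AffineSpace.homOfVector_over]
    · rw [hc, AffineSpace.homOfVector_appTop_coord, Hom.comp_appTop, CommRingCat.comp_apply,
        AffineSpace.map_appTop_coord, AffineSpace.homOfVector_appTop_coord]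
  have : UniversallyClosed (AffineSpace.map F h) :=
    MorphismProperty.of_isPullback (AffineSpace.isPullback_map (n := F) h).flip inferInstance
  have h1 : IsIntegralHom c := by
    rw [IsIntegralHom.iff_universallyClosed_and_isAffineHom]
    exact ⟨hm ▸ inferInstance, isAffineHom_of_isAffine_of_isSeparated _⟩
  obtain ⟨h', hr⟩ := range_homOfVector_appLE (m ≫ h) (isAffineOpen_top X)
    (fun a : F ↦ (a : Γ(W, ⊤)))
  have hr' : c.appTop.hom.range = Subring.closure (Set.range (m ≫ h).appTop ∪ F) := by
    have e : c.appLE _ _ h'.le = c.appTop := (Hom.app_eq_appLE (f := c)).symm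
    rw [sectionsSubring, ← hc, e] at hr
    refine hr.trans ?_
    congr 2
    rw [← Set.range_comp]
    refine Eq.trans ?_ (Subtype.range_coe (s := (F : Set Γ(W, ⊤))))
    congr 1
    funext a
    exact res_self _
  obtain ⟨p, hp, hps⟩ := c.isIntegral_app ⊤ (isAffineOpen_top _) s
  rw [← hr']
  refine ⟨p.map c.appTop.hom.rangeRestrict, hp.map _, ?_⟩
  rw [Polynomial.eval₂_map]
  exact hps

theorem app_basicOpen_surjective {W X : Scheme.{u}} [IsAffine W] (f : W ⟶ X) (b : Γ(X, ⊤))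
    (hb : ∀ s : Γ(W, ⊤), ∃ n : ℕ, f.appTop b ^ n * s ∈ f.appTop.hom.range) :
    Function.Surjective (f.app (X.basicOpen b)) := by
  intro t
  have e : f ⁻¹ᵁ X.basicOpen b = W.basicOpen (f.appTop b) := preimage_basicOpen_top f b
  let := (W.presheaf.map (homOfLE (le_top : f ⁻¹ᵁ X.basicOpen b ≤ ⊤)).op).hom.toAlgebra
  have hloc : IsLocalization.Away (f.appTop b) Γ(W, f ⁻¹ᵁ X.basicOpen b) :=
    (isAffineOpen_top W).isLocalization_of_eq_basicOpen (f.appTop b) (homOfLE le_top) e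
  have halg (s : Γ(W, ⊤)) : algebraMap Γ(W, ⊤) Γ(W, f ⁻¹ᵁ X.basicOpen b) s =
    W.res le_top s := rfl
  obtain ⟨n, s, hs⟩ := IsLocalization.Away.surj (f.appTop b) t
  obtain ⟨m, a, ha⟩ := hb s
  replace ha : f.appTop a = f.appTop b ^ m * s := ha
  have hf (c : Γ(X, ⊤)) : f.app (X.basicOpen b) (X.res le_top c) = W.res le_top (f.appTop c) :=
    app_res f le_top c
  have hu : IsUnit (X.res (le_top : X.basicOpen b ≤ ⊤) b) :=
    RingedSpace.isUnit_res_basicOpen X.toRingedSpace b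
  obtain ⟨v, hv⟩ := hu.exists_right_inv
  refine ⟨X.res le_top a * v ^ (m + n), ?_⟩
  have hv' := congr(f.app (X.basicOpen b) $hv)
  rw [map_mul, map_one, hf] at hv'
  rw [map_mul, map_pow, hf, ha, map_mul, map_pow, ← halg s, ← hs, halg, ← mul_assoc, mul_comm,
    ← mul_assoc, mul_comm]
  set r := W.res le_top (f.appTop b)
  set v' := f.app (X.basicOpen b) v
  calc r ^ n * (v' ^ (m + n) * (r ^ m * t)) = t * (r * v') ^ (m + n) := by ring
    _ = t := by rw [hv', one_pow, mul_one]

theorem comap_appTop_toSpecΓ {W X : Scheme.{u}} (f : W ⟶ X) (w : W) :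
    (W.toSpecΓ w).comap f.appTop.hom = X.toSpecΓ (f w) :=
  (congrArg (fun k : W ⟶ Spec Γ(X, ⊤) ↦ k w) (toSpecΓ_naturality f)).symm

theorem toSpecΓ_injective (X : Scheme.{u}) [IsAffine X] : Function.Injective X.toSpecΓ :=
  X.toSpecΓ.isOpenEmbedding.injective

theorem isIso_of_isOpenImmersion_of_universallyClosed_comp {A B D : Scheme.{u}} (m : A ⟶ B)
    (k : B ⟶ D) [IsOpenImmersion m] [IsSeparated k] [PreconnectedSpace B] [Nonempty A]
    [UniversallyClosed (m ≫ k)] : IsIso m := by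
  have : UniversallyClosed m := UniversallyClosed.of_comp_of_isSeparated m k
  have : Surjective m := ⟨by
    rw [← Set.range_eq_univ]
    exact IsClopen.eq_univ ⟨m.isClosedMap.isClosed_range, m.isOpenEmbedding.isOpen_range⟩
      (Set.range_nonempty _)⟩
  have : Epi m.base := (TopCat.epi_iff_surjective _).mpr m.surjective
  exact IsOpenImmersion.isIso m

theorem isAffineOpen_preimage_of_surjective {W Z X : Scheme.{u}} [IrreducibleSpace Z] [IsAffine W]
    [Z.IsSeparated]
    (j : W ⟶ Z) [IsOpenImmersion j] (h : Z ⟶ X) (b : Γ(X, ⊤)) [IsAffine X]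
    (hs : Function.Surjective ((j ≫ h).app (X.basicOpen b))) (w : W)
    (hw : h (j w) ∈ X.basicOpen b) : IsAffineOpen (h ⁻¹ᵁ X.basicOpen b) := by
  have h1 := morphismRestrict_appTop_surjective (j ≫ h) (U := X.basicOpen b) rfl (by
    rw [← Hom.app_eq_appLE]
    exact hs)
  have hU : IsAffineOpen (X.basicOpen b) := (isAffineOpen_top X).basicOpen b
  have : IsAffine (X.basicOpen b) := hU
  have : IsAffine ((j ≫ h) ⁻¹ᵁ X.basicOpen b) := by
    change IsAffineOpen _
    exact hU.preimage (j ≫ h)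
  have : IsClosedImmersion ((j ≫ h) ∣_ X.basicOpen b) :=
    IsClosedImmersion.of_surjective_of_isAffine _ h1
  have h3 : UniversallyClosed ((j ≫ h) ∣_ X.basicOpen b) := inferInstance
  rw [morphismRestrict_comp] at h3
  have : IsSeparated h := .of_comp h (Limits.terminal.from _)
  have : PreconnectedSpace (h ⁻¹ᵁ X.basicOpen b : Z.Opens) := Subtype.preconnectedSpace
    ((PreirreducibleSpace.isPreirreducible_univ.open_subset (h ⁻¹ᵁ X.basicOpen b).2 (Set.subset_univ _)).isPreconnected)
  have : Nonempty (j ⁻¹ᵁ h ⁻¹ᵁ X.basicOpen b : W.Opens) := ⟨⟨w, hw⟩⟩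
  have : IsIso (j ∣_ h ⁻¹ᵁ X.basicOpen b) :=
    have : UniversallyClosed (j ∣_ h ⁻¹ᵁ X.basicOpen b ≫ h ∣_ X.basicOpen b) :=
      h3
    isIso_of_isOpenImmersion_of_universallyClosed_comp _ (h ∣_ X.basicOpen b)
  have : IsAffine (j ⁻¹ᵁ h ⁻¹ᵁ X.basicOpen b : W.Opens) := by assumption
  exact IsAffine.of_isIso (inv (j ∣_ h ⁻¹ᵁ X.basicOpen b))

theorem span_eq_top_of_forall_exists {X : Scheme.{u}} [IsAffine X] (s : Set Γ(X, ⊤))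
    (hs : ∀ x : X, ∃ b ∈ s, x ∈ X.basicOpen b) : Ideal.span s = ⊤ := by
  by_contra h
  obtain ⟨M, hM, hle⟩ := Ideal.exists_le_maximal _ h
  obtain ⟨x, hx⟩ := exists_mem_basicOpen_iff_notMem M
  obtain ⟨b, hb, hxb⟩ := hs x
  exact (hx b).mp hxb (hle (Ideal.subset_span hb))

/-- A variant of Zariski's main theorem: a universally closed morphism from an irreducible scheme
to an affine scheme, without specializations in its fibres and such that the target is integrally
closed in the source, has affine source. -/
theorem isAffine_of_forall_specializes_of_integrallyClosed {Z X : Scheme.{u}} [IsAffine X]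
    [IrreducibleSpace Z] [Z.IsSeparated] (h : Z ⟶ X) [UniversallyClosed h] [Surjective h]
    (hint : ∀ W : Z.Opens, IsAffineOpen W → (W : Set Z).Nonempty → ∀ s : Γ(W, ⊤),
      (W.ι ≫ h).appTop.hom.IsIntegralElem s → s ∈ (W.ι ≫ h).appTop.hom.range)
    (hspec : ∀ z z' : Z, z ⤳ z' → h z = h z' → z = z') : IsAffine Z := by
  have : CompactSpace Z := QuasiCompact.compactSpace_of_compactSpace h
  have key (z : Z) : ∃ b : Γ(X, ⊤), h z ∈ X.basicOpen b ∧
      IsAffineOpen (h ⁻¹ᵁ X.basicOpen b) := by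
    obtain ⟨⟨V, hV⟩, hzV, -⟩ := exists_affineOpens_le (x := z) (V := ⊤) trivial
    obtain ⟨W, j, w, _, hj, rfl, hint'⟩ : ∃ (W : Scheme.{u}) (j : W ⟶ Z) (w : W),
        IsAffine W ∧ IsOpenImmersion j ∧ j w = z ∧ ∀ s : Γ(W, ⊤),
          (j ≫ h).appTop.hom.IsIntegralElem s → s ∈ (j ≫ h).appTop.hom.range :=
      ⟨V, V.ι, ⟨z, hzV⟩, hV, inferInstance, rfl, hint V hV ⟨z, hzV⟩⟩
    obtain ⟨F, hF⟩ := exists_finset_isIntegralElem_of_universallyClosed j h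
    let := (j ≫ h).appTop.hom.toAlgebra
    have halg : algebraMap Γ(X, ⊤) Γ(W, ⊤) = (j ≫ h).appTop.hom := rfl
    have hsurj (x : PrimeSpectrum Γ(W, ⊤)) : ∃ x' : W, W.toSpecΓ x' = x :=
      W.toSpecΓ.homeomorph.surjective x
    have hinj {x y : W} (hxy : (W.toSpecΓ x).comap (algebraMap Γ(X, ⊤) Γ(W, ⊤)) =
        (W.toSpecΓ y).comap (algebraMap Γ(X, ⊤) Γ(W, ⊤))) : (j ≫ h) x = (j ≫ h) y := by
      refine X.toSpecΓ_injective ?_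
      rwa [halg, comap_appTop_toSpecΓ, comap_appTop_toSpecΓ] at hxy
    obtain ⟨b, hb, hbs⟩ := Algebra.exists_notMem_forall_pow_mul_mem (R := Γ(X, ⊤)) (S := Γ(W, ⊤))
      F.finite_toSet (fun s ↦ by
        obtain ⟨p, hp, hps⟩ := hF s
        have hle : Subring.closure (Set.range (j ≫ h).appTop ∪ F) =
          (Algebra.adjoin Γ(X, ⊤) (F : Set Γ(W, ⊤))).toSubring :=
            (Algebra.adjoin_eq_ring_closure ..).symm
        clear hF
        revert p
        rw [hle]
        exact fun p hp hps ↦ ⟨p, hp, hps⟩) (fun s hs ↦ hint' s hs)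
      (W.toSpecΓ w) fun x y hxy hx hy ↦ by
        obtain ⟨x, rfl⟩ := hsurj x
        obtain ⟨y, rfl⟩ := hsurj y
        congr 1
        refine j.isOpenEmbedding.injective (hspec _ _ ?_ ?_)
        · refine Specializes.map ?_ j.continuous
          refine W.toSpecΓ.isOpenEmbedding.isInducing.specializes_iff.mp ?_
          exact (PrimeSpectrum.le_iff_specializes _ _).mp hxy
        · exact hinj (hx.trans hy.symm)
    have hw : h (j w) ∈ X.basicOpen b := by
      refine (mem_basicOpen_app (j ≫ h) b w).mp ?_
      refine (W.toSpecΓ_preimage_basicOpen ((j ≫ h).appTop b)).le ?_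
      exact hb
    exact ⟨b, hw, isAffineOpen_preimage_of_surjective j h b
      (app_basicOpen_surjective _ b hbs) w hw⟩
  choose b hb hb' using key
  refine isAffine_of_isAffineOpen_basicOpen (Set.range fun z ↦ h.appTop (b z)) ?_ ?_
  · have h1 : Ideal.span (Set.range b) = ⊤ := by
      refine span_eq_top_of_forall_exists _ fun x ↦ ?_
      obtain ⟨z, rfl⟩ := h.surjective x
      exact ⟨_, ⟨z, rfl⟩, hb z⟩
    have h2 := congr(Ideal.map h.appTop.hom $h1)
    rwa [Ideal.map_span, Ideal.map_top, ← Set.range_comp] at h2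
  · rintro _ ⟨z, rfl⟩
    rw [← preimage_basicOpen_top]
    exact hb' z

theorem eq_of_specializes_of_morphismRestrict {Z Y : Scheme.{u}} (f : Z ⟶ Y) (U : Y.Opens)
    (H : ∀ w w' : (f ⁻¹ᵁ U : Z.Opens), w ⤳ w' → (f ∣_ U) w = (f ∣_ U) w' → w = w')
    {z z' : Z} (h : z ⤳ z') (hf : f z = f z') (hU : f z' ∈ U) : z = z' := by
  let w : (f ⁻¹ᵁ U : Z.Opens) := ⟨z, by change f z ∈ U; rwa [hf]⟩
  let w' : (f ⁻¹ᵁ U : Z.Opens) := ⟨z', hU⟩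
  have hres (w : (f ⁻¹ᵁ U : Z.Opens)) : U.ι ((f ∣_ U) w) = f ((f ⁻¹ᵁ U).ι w) :=
    congrArg (fun k : (f ⁻¹ᵁ U : Z.Opens).toScheme ⟶ Y ↦ k w) (morphismRestrict_ι f U)
  have hww : w ⤳ w' := (f ⁻¹ᵁ U).ι.isOpenEmbedding.isInducing.specializes_iff.mp h
  exact congr((f ⁻¹ᵁ U).ι $(H w w' hww
    (U.ι.isOpenEmbedding.injective ((hres w).trans (hf.trans (hres w').symm)))))

/-- There are no nontrivial specializations in the fibres of an integral morphism. -/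
theorem eq_of_specializes_of_isIntegralHom {Z Y : Scheme.{u}} (f : Z ⟶ Y) [IsIntegralHom f]
    {z z' : Z} (h : z ⤳ z') (hf : f z = f z') : z = z' := by
  wlog hY : IsAffine Y generalizing Y Z
  · obtain ⟨U, hU, -⟩ := exists_affineOpens_le (x := f z') (V := ⊤) trivial
    exact eq_of_specializes_of_morphismRestrict f U.1 (fun w w' hw hww ↦ this _ hw hww U.2) h hf hU
  have : IsAffine Z := isAffine_of_isAffineHom f
  refine Z.toSpecΓ_injective ?_
  by_contra hne
  let := f.appTop.hom.toAlgebra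
  have hle := (PrimeSpectrum.le_iff_specializes _ _).mpr (h.map Z.toSpecΓ.continuous)
  have hlt : (Z.toSpecΓ z).asIdeal < (Z.toSpecΓ z').asIdeal := lt_of_le_of_ne hle fun e ↦ hne (PrimeSpectrum.ext e)
  obtain ⟨x, hx, hx'⟩ := SetLike.exists_of_lt hlt
  have hprime : (Z.toSpecΓ z).asIdeal.IsPrime := PrimeSpectrum.isPrime (Z.toSpecΓ z)
  refine (Ideal.comap_lt_comap_of_integral_mem_sdiff (R := Γ(Y, ⊤)) hle ⟨hx, hx'⟩
    (f.isIntegral_app ⊤ (isAffineOpen_top _) x)).ne ?_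
  have := congr(Y.toSpecΓ $hf)
  rw [← comap_appTop_toSpecΓ, ← comap_appTop_toSpecΓ] at this
  exact congr(PrimeSpectrum.asIdeal $this)

theorem exists_section_of_isIntegralHom {L : Type u} [Field L] [IsAlgClosed L] {P : Scheme.{u}}
    [Nonempty P] (q : P ⟶ Spec (.of L)) [IsIntegralHom q] :
    ∃ s : Spec (.of L) ⟶ P, s ≫ q = 𝟙 _ := by
  have : IsAffine P := isAffine_of_isAffineHom q
  obtain ⟨φ, hφ⟩ := Spec.map_surjective (P.isoSpec.inv ≫ q)
  have hint : φ.hom.IsIntegral := IsIntegralHom.SpecMap_iff.mp (hφ ▸ inferInstance)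
  have : Nontrivial Γ(P, ⊤) := by
    refine PrimeSpectrum.nonempty_iff_nontrivial.mp ?_
    exact ⟨P.toSpecΓ (Classical.arbitrary P)⟩
  obtain ⟨m, hm⟩ := Ideal.exists_maximal Γ(P, ⊤)
  let := φ.hom.toAlgebra
  have : Algebra.IsIntegral L Γ(P, ⊤) := ⟨hint⟩
  have : Algebra.IsIntegral L (Γ(P, ⊤) ⧸ m) := inferInstance
  let e := RingEquiv.ofBijective _
    (IsAlgClosed.algebraMap_bijective_of_isIntegral (k := L) (K := Γ(P, ⊤) ⧸ m))
  let ψ : Γ(P, ⊤) →+* L := (e.symm : (Γ(P, ⊤) ⧸ m) →+* L).comp (Ideal.Quotient.mk m)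
  have hψ : φ ≫ CommRingCat.ofHom ψ = 𝟙 _ := by
    ext x
    exact e.symm_apply_apply x
  refine ⟨Spec.map (CommRingCat.ofHom ψ) ≫ P.isoSpec.inv, ?_⟩
  rw [Category.assoc, ← hφ, ← Spec.map_comp, hψ, Spec.map_id]

theorem exists_lift_fromFunctionField {Z Y : Scheme.{u}} [IsIntegral Y] (L : Type u) [Field L]
    [IsAlgClosed L] [Algebra Y.functionField L] (p : Z ⟶ Y) [IsIntegralHom p] [Surjective p] :
    ∃ s : Spec (.of L) ⟶ Z, s ≫ p = Y.fromFunctionField L := by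
  have : Nonempty (Spec (.of L)) := inferInstanceAs (Nonempty (PrimeSpectrum L))
  have : Nonempty (Limits.pullback p (Y.fromFunctionField L) : Scheme) :=
    ⟨((Limits.pullback.snd p (Y.fromFunctionField L)).surjective (Classical.arbitrary _)).choose⟩
  obtain ⟨s, hs⟩ := exists_section_of_isIntegralHom
    (Limits.pullback.snd p (Y.fromFunctionField L))
  refine ⟨s ≫ Limits.pullback.fst _ _, ?_⟩
  rw [Category.assoc, Limits.pullback.condition, ← Category.assoc, hs, Category.id_comp]

theorem exists_integralClosure_factorization {L : Type u} [Field L] {X : Scheme.{u}} [IsAffine X]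
    (a : Spec (.of L) ⟶ X) : ∃ (N : Scheme.{u}) (b : Spec (.of L) ⟶ N) (n : N ⟶ X),
      IsAffine N ∧ IsIntegral N ∧ IsDominant b ∧ IsIntegralHom n ∧ b ≫ n = a ∧
      ∀ x : Γ(Spec (.of L), ⊤), b.appTop.hom.IsIntegralElem x → x ∈ b.appTop.hom.range := by
  obtain ⟨φ, hφ⟩ := Spec.map_surjective (a ≫ X.isoSpec.hom)
  let := φ.hom.toAlgebra
  let B := integralClosure Γ(X, ⊤) L
  let ι : CommRingCat.of B ⟶ .of L := CommRingCat.ofHom (algebraMap B L)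
  let ν : Γ(X, ⊤) ⟶ CommRingCat.of B := CommRingCat.ofHom (algebraMap Γ(X, ⊤) B)
  have hι : ν ≫ ι = φ := rfl
  refine ⟨Spec (.of B), Spec.map ι, Spec.map ν ≫ X.isoSpec.inv, inferInstance, inferInstance,
    ⟨?_⟩, ?_, ?_, fun x hx ↦ ?_⟩
  · refine (PrimeSpectrum.denseRange_comap_iff_ker_le_nilRadical ι.hom).mpr ?_
    rw [(RingHom.injective_iff_ker_eq_bot _).mp Subtype.val_injective]
    exact bot_le
  · have : IsIntegralHom (Spec.map ν) := IsIntegralHom.SpecMap_iff.mpr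
      (algebraMap_isIntegral_iff.mpr inferInstance)
    infer_instance
  · rw [← Category.assoc, ← Spec.map_comp, hι, hφ, Category.assoc, Iso.hom_inv_id,
      Category.comp_id]
  · obtain ⟨p, hp, hpx⟩ := hx
    have hnat' (y : Γ(Spec (.of B), ⊤)) : (ΓSpecIso (.of L)).hom ((Spec.map ι).appTop y) =
        algebraMap B L ((ΓSpecIso (.of B)).hom y) :=
      ConcreteCategory.congr_hom (ΓSpecIso_naturality ι) y
    have hnat (y : B) : (ΓSpecIso (.of L)).hom ((Spec.map ι).appTop ((ΓSpecIso (.of B)).inv y)) =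
        algebraMap B L y :=
      (hnat' _).trans (congrArg (algebraMap B L)
        (ConcreteCategory.congr_hom (ΓSpecIso (.of B)).inv_hom_id y))
    have h1 : (ΓSpecIso (.of L)).hom x ∈ integralClosure B L := by
      refine ⟨p.map (ΓSpecIso (.of B)).hom.hom, hp.map _, ?_⟩
      have h3 : (algebraMap B L).comp (ΓSpecIso (.of B)).hom.hom =
          (ΓSpecIso (.of L)).hom.hom.comp (Spec.map ι).appTop.hom :=
        RingHom.ext fun y ↦ (hnat' y).symm
      rw [Polynomial.eval₂_map, h3, ← Polynomial.hom_eval₂, hpx, map_zero]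
    have h2 : (ΓSpecIso (.of L)).hom x ∈ (⊥ : Subalgebra B L) := by
      rwa [← integralClosure_idem]
    obtain ⟨y, hy⟩ := Algebra.mem_bot.mp h2
    refine ⟨(ΓSpecIso (.of B)).inv y, ?_⟩
    refine (ConcreteCategory.bijective_of_isIso (ΓSpecIso (.of L)).hom).1 ?_
    exact (hnat y).trans hy

theorem isSeparated_of_hom {Z Y : Scheme.{u}} (f : Z ⟶ Y) [IsSeparated f] [Y.IsSeparated] :
    Z.IsSeparated := by
  have e : Limits.terminal.from Z = f ≫ Limits.terminal.from Y := Subsingleton.elim _ _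
  exact ⟨e ▸ inferInstance⟩

theorem mem_range_of_isIntegralElem_of_isDominant {L : Type u} [Field L]
    {Z N : Scheme.{u}} [IsIntegral Z] (j : Spec (.of L) ⟶ Z) [IsDominant j] (h : Z ⟶ N)
    (hj : ∀ x : Γ(Spec (.of L), ⊤), (j ≫ h).appTop.hom.IsIntegralElem x →
      x ∈ (j ≫ h).appTop.hom.range) (W : Z.Opens) (hW : (W : Set Z).Nonempty) (s : Γ(W, ⊤))
    (hs : (W.ι ≫ h).appTop.hom.IsIntegralElem s) : s ∈ (W.ι ≫ h).appTop.hom.range := by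
  have hsub : Subsingleton (Spec (.of L)) := inferInstanceAs (Subsingleton (PrimeSpectrum L))
  have hrange : Set.range j ⊆ Set.range W.ι := by
    obtain ⟨x, hx⟩ := j.denseRange.exists_mem_open W.2 hW
    rintro _ ⟨y, rfl⟩
    rw [W.range_ι, Subsingleton.elim y x]
    exact hx
  let k := IsOpenImmersion.lift W.ι j hrange
  have hk : k ≫ W.ι = j := IsOpenImmersion.lift_fac _ _ _
  have : IsDominant k := ⟨by
    have := j.denseRange.preimage W.ι.isOpenEmbedding.isOpenMap
    have e : W.ι ⁻¹' Set.range j = Set.range k := by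
      rw [← hk]
      ext x
      simp only [Set.mem_range, Set.mem_preimage]
      exact exists_congr fun y ↦ W.ι.isOpenEmbedding.injective.eq_iff
    rwa [e] at this⟩
  have : Nonempty W := hW.to_subtype
  have : IsIntegral W := inferInstance
  have : QuasiCompact k := ⟨fun U _ _ ↦ (Set.toFinite _).isCompact⟩
  have := IsSchemeTheoreticallyDominant.of_isDominant k
  have hcomp (x) : (j ≫ h).appTop x = k.appTop ((W.ι ≫ h).appTop x) := by
    have : j ≫ h = k ≫ W.ι ≫ h := by rw [← hk, Category.assoc]
    rw [this, Hom.comp_appTop]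
    rfl
  obtain ⟨y, hy⟩ := hj (k.appTop s) (by
    have := hs.map k.appTop.hom
    have e : k.appTop.hom.comp (W.ι ≫ h).appTop.hom = (j ≫ h).appTop.hom :=
      RingHom.ext fun x ↦ (hcomp x).symm
    rwa [e] at this)
  exact ⟨y, k.app_injective ⊤ ((hcomp y).symm.trans hy)⟩

theorem isAffine_of_isIntegral_of_forall_specializes {X Y Z : Scheme.{u}} [IsAffine X]
    [IsIntegral Y] [Y.IsSeparated] (g : Z ⟶ X) [UniversallyClosed g] (p : Z ⟶ Y)
    [IsIntegralHom p] [Surjective p] (hspec : ∀ z z' : Z, z ⤳ z' → g z = g z' → z = z')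
    (hJ : ∀ J : Y.IdealSheafData, J ≠ ⊥ → IsAffine J.subscheme) : IsAffine Y := by
  let L := AlgebraicClosure Y.functionField
  obtain ⟨s, hs⟩ := exists_lift_fromFunctionField L p
  obtain ⟨N, b, n, _, _, _, _, hbn, hb⟩ := exists_integralClosure_factorization (s ≫ g)
  let t : Spec (.of L) ⟶ Limits.pullback g n := Limits.pullback.lift s b hbn.symm
  have : (Limits.pullback g n).IsSeparated := isSeparated_of_hom (Limits.pullback.fst g n ≫ p)
  have : IsAffineHom t := isAffineHom_of_isAffine_of_isSeparated t
  have := isIntegral_image t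
  have : t.image.IsSeparated := isSeparated_of_hom t.imageι
  have hjh : t.toImage ≫ t.imageι ≫ Limits.pullback.snd g n = b := by
    rw [← Category.assoc, Hom.toImage_imageι, Limits.pullback.lift_snd]
  have hjf : t.toImage ≫ t.imageι ≫ Limits.pullback.fst g n ≫ p = Y.fromFunctionField L := by
    rw [← Category.assoc, Hom.toImage_imageι, ← Category.assoc, Limits.pullback.lift_fst, hs]
  have : IsDominant (t.imageι ≫ Limits.pullback.snd g n) := by
    have : IsDominant (t.toImage ≫ t.imageι ≫ Limits.pullback.snd g n) := hjh ▸ inferInstance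
    exact IsDominant.of_comp t.toImage _
  have : Surjective (t.imageι ≫ Limits.pullback.snd g n) :=
    Surjective.of_universallyClosed_of_isDominant _
  have : IsAffine t.image := by
    refine isAffine_of_forall_specializes_of_integrallyClosed
      (t.imageι ≫ Limits.pullback.snd g n) (fun W _ hW s hs ↦ ?_) fun z z' hz hzz ↦ ?_
    · refine mem_range_of_isIntegralElem_of_isDominant t.toImage _ ?_ W hW s hs
      rw [hjh]
      exact hb
    · have hu := hz.map t.imageι.continuous
      have hgn (x : (Limits.pullback g n : Scheme)) : g (Limits.pullback.fst g n x) =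
          n (Limits.pullback.snd g n x) :=
        congrArg (fun k : Limits.pullback g n ⟶ X ↦ k x) Limits.pullback.condition
      refine t.imageι.isClosedEmbedding.injective
        (eq_of_specializes_of_isIntegralHom (Limits.pullback.fst g n) hu
          (hspec _ _ (hu.map (Limits.pullback.fst g n).continuous) ?_))
      rw [hgn, hgn]
      exact congr(n $hzz)
  exact isAffine_of_isIntegralHom_of_algebraicClosure L t.toImage _ hjf.symm hJ

/-- Let `Z` be integral and surjective over `Y` and universally closed over an affine scheme `X`.
If there are no specializations in the fibres of `Z` over `X`, then `Y` is affine. -/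
theorem isAffine_of_forall_specializes {X Y Z : Scheme.{u}} [IsAffine X]
    [Y.IsSeparated] (g : Z ⟶ X) [UniversallyClosed g] (p : Z ⟶ Y)
    [IsIntegralHom p] [Surjective p] (hspec : ∀ z z' : Z, z ⤳ z' → g z = g z' → z = z') :
    IsAffine Y := by
  by_contra hY
  have : CompactSpace Z := QuasiCompact.compactSpace_of_compactSpace g
  have : CompactSpace Y := p.surjective.compactSpace p.continuous
  obtain ⟨Y', i, _, hY', hJ⟩ := exists_minimal_not_isAffine hY
  have : CompactSpace Y' := QuasiCompact.compactSpace_of_compactSpace i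
  have : Y'.IsSeparated := isSeparated_of_hom i
  have := isIntegral_of_not_isAffine hY' hJ
  refine hY' (isAffine_of_isIntegral_of_forall_specializes (Limits.pullback.fst p i ≫ g)
    (Limits.pullback.snd p i) (fun z z' hz hzz ↦ ?_) hJ)
  exact (Limits.pullback.fst p i).isClosedEmbedding.injective
    (hspec _ _ (hz.map (Limits.pullback.fst p i).continuous) hzz)

theorem eq_of_specializes_of_mem_range {X Y Y₀ Z : Scheme.{u}} [IsAffine X] [IsAffine Y₀]
    (i : Y₀ ⟶ Y) [IsClosedImmersion i] (g : Z ⟶ X) [UniversallyClosed g] (p : Z ⟶ Y)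
    [IsAffineHom p] {z z' : Z} (h : z ⤳ z') (hg : g z = g z') (hz : p z ∈ Set.range i)
    (hz' : p z' ∈ Set.range i) : z = z' := by
  have : IsAffine (Limits.pullback p i) := isAffine_of_isAffineHom (Limits.pullback.snd p i)
  have : IsIntegralHom (Limits.pullback.fst p i ≫ g) := by
    rw [IsIntegralHom.iff_universallyClosed_and_isAffineHom]
    exact ⟨inferInstance, inferInstance⟩
  have hrange : Set.range (Limits.pullback.fst p i) = p ⁻¹' Set.range i :=
    Pullback.range_fst p i
  obtain ⟨w, rfl⟩ : z ∈ Set.range (Limits.pullback.fst p i) := hrange ▸ hz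
  obtain ⟨w', rfl⟩ : z' ∈ Set.range (Limits.pullback.fst p i) := hrange ▸ hz'
  rw [eq_of_specializes_of_isIntegralHom (Limits.pullback.fst p i ≫ g)
    ((Limits.pullback.fst p i).isClosedEmbedding.isInducing.specializes_iff.mp h) hg]

end AlgebraicGeometry.Scheme

/-- The correspondence lemma for affineness (Lemma 2.32 / `correspondence affine` in
Caraiani–Scholze): given a commutative diagram of schemes with closed immersions
`iX : X₀ ⟶ X`, `iC : C₀ ⟶ C`, `iY : Y₀ ⟶ Y` and morphisms `π₁ : C ⟶ X`, `π₂ : C ⟶ Y`,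
such that `C₀` is topologically the preimage of `X₀` under `π₁` and of `Y₀` under `π₂`,
with `X`, `X₀`, `Y₀` affine, `π₁`, `π₂` proper and surjective, and finite away from the
boundary (i.e. the restrictions over the open complements `X ∖ X₀` resp. `Y ∖ Y₀` are
finite), then `Y` is affine. -/
theorem isAffine_of_correspondence {X₀ X C₀ C Y₀ Y : Scheme}
    (iX : X₀ ⟶ X) (iC : C₀ ⟶ C) (iY : Y₀ ⟶ Y)
    (π₁ : C ⟶ X) (π₂ : C ⟶ Y) (c₁ : C₀ ⟶ X₀) (c₂ : C₀ ⟶ Y₀)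
    [IsClosedImmersion iX] [IsClosedImmersion iC] [IsClosedImmersion iY]
    (hcomm₁ : iC ≫ π₁ = c₁ ≫ iX) (hcomm₂ : iC ≫ π₂ = c₂ ≫ iY)
    (hpre₁ : π₁.base ⁻¹' (Set.range iX.base) = Set.range iC.base)
    (hpre₂ : π₂.base ⁻¹' (Set.range iY.base) = Set.range iC.base)
    [IsAffine X] [IsAffine X₀] [IsAffine Y₀]
    [IsProper π₁] [IsProper π₂]
    [AlgebraicGeometry.Surjective π₁] [AlgebraicGeometry.Surjective π₂]
    (hfin₁ : IsFinite (π₁ ∣_ ⟨(Set.range iX.base)ᶜ, iX.isClosedEmbedding.isClosed_range.isOpen_compl⟩))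
    (hfin₂ : IsFinite (π₂ ∣_ ⟨(Set.range iY.base)ᶜ, iY.isClosedEmbedding.isClosed_range.isOpen_compl⟩)) :
    IsAffine Y := by
  have : C.IsSeparated := Scheme.isSeparated_of_hom π₁
  have : Y.IsSeparated := Scheme.isSeparated_of_universallyClosed_of_surjective π₂
  let P : Scheme := Limits.pullback (Limits.terminal.from X) (Limits.terminal.from Y)
  let fst : P ⟶ X := Limits.pullback.fst _ _
  let snd : P ⟶ Y := Limits.pullback.snd _ _
  have : IsSeparated fst := inferInstanceAs (IsSeparated (Limits.pullback.fst _ _))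
  have : IsAffineHom (Limits.terminal.from X) := inferInstance
  have : IsAffineHom snd := MorphismProperty.of_isPullback
    (IsPullback.of_hasPullback (Limits.terminal.from X) (Limits.terminal.from Y)) inferInstance
  let q : C ⟶ P := Limits.pullback.lift π₁ π₂ (Subsingleton.elim _ _)
  have hq₁ : q ≫ fst = π₁ := Limits.pullback.lift_fst _ _ _
  have hq₂ : q ≫ snd = π₂ := Limits.pullback.lift_snd _ _ _
  have : UniversallyClosed (q ≫ fst) := hq₁ ▸ inferInstance
  have : UniversallyClosed q := UniversallyClosed.of_comp_of_isSeparated q fst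
  let e : C ⟶ q.image := q.toImage
  let g : q.image ⟶ X := q.imageι ≫ fst
  let p : q.image ⟶ Y := q.imageι ≫ snd
  have heq : e ≫ q.imageι = q := q.toImage_imageι
  have heg : e ≫ g = π₁ := by rw [← Category.assoc, heq, hq₁]
  have hep : e ≫ p = π₂ := by rw [← Category.assoc, heq, hq₂]
  have : UniversallyClosed (e ≫ q.imageι) := by rwa [heq]
  have : UniversallyClosed e := UniversallyClosed.of_comp_of_isSeparated e q.imageι
  have : IsDominant e := inferInstanceAs (IsDominant q.toImage)
  have : Surjective e := Surjective.of_universallyClosed_of_isDominant e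
  have : UniversallyClosed (e ≫ g) := heg ▸ inferInstance
  have : UniversallyClosed g := UniversallyClosed.of_comp_surjective e g
  have : UniversallyClosed (e ≫ p) := hep ▸ inferInstance
  have : UniversallyClosed p := UniversallyClosed.of_comp_surjective e p
  have : Surjective (e ≫ p) := hep ▸ inferInstance
  have : Surjective p := Surjective.of_comp e p
  have : IsAffineHom p := inferInstanceAs (IsAffineHom (q.imageι ≫ snd))
  have : IsIntegralHom p := by
    rw [IsIntegralHom.iff_universallyClosed_and_isAffineHom]
    exact ⟨inferInstance, inferInstance⟩
  have hg (c : C) : g (e c) = π₁ c := congrArg (fun k : C ⟶ X ↦ k c) heg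
  have hp (c : C) : p (e c) = π₂ c := congrArg (fun k : C ⟶ Y ↦ k c) hep
  refine Scheme.isAffine_of_forall_specializes g p fun z z' hz hzz ↦ ?_
  by_cases hx : g z' ∈ Set.range iX
  · have hmem (w : q.image) (hw : g w ∈ Set.range iX) : p w ∈ Set.range iY := by
      obtain ⟨c, rfl⟩ := e.surjective w
      rw [hg] at hw
      rw [hp]
      exact hpre₂.ge (hpre₁.le hw)
    exact Scheme.eq_of_specializes_of_mem_range iY g p hz hzz (hmem z (hzz ▸ hx)) (hmem z' hx)
  · obtain ⟨c, rfl⟩ := e.surjective z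
    obtain ⟨c', hc', rfl⟩ := e.isClosedMap.specializingMap hz
    rw [hg, hg] at hzz
    rw [hg] at hx
    rw [Scheme.eq_of_specializes_of_morphismRestrict π₁
      ⟨(Set.range iX)ᶜ, iX.isClosedEmbedding.isClosed_range.isOpen_compl⟩
      (fun w w' hw hww ↦ Scheme.eq_of_specializes_of_isIntegralHom _ hw hww) hc' hzz hx]
end

section
/- Let G be a group and let P and K be subgroups of G such that G = K·P, i.e., every element of G can be written as a product of an element of K and an element of P. Let M be a left P-module (an abelian group with a linear left P-action), and let Ind_P^G M denote the abelian group of all functions f : G → M satisfying f(gp) = p⁻¹·f(g) for all g ∈ G and p ∈ P, equipped with the left G-action (h·f)(g) = f(h⁻¹g). Then evaluation at the identity element of G, f ↦ f(1), defines an isomorphism of abelian groups from the K-invariants (Ind_P^G M)^K onto the (K ∩ P)-invariants M^{K∩P}. -/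
section

variable {G : Type*} [Group G] (K P : Subgroup G)
variable (M : Type*) [AddCommGroup M] [DistribMulAction P M]

/-- The `K`-invariants of the (unnormalized) induced module `Ind_P^G M`: functions
`F : G → M` with `F (g p) = p⁻¹ • F g` for all `p ∈ P`, invariant under the `G`-action
`(k • F) g = F (k⁻¹ g)` for all `k ∈ K`. -/
def indInvariants : AddSubgroup (G → M) where
  carrier := {F | (∀ (g : G) (p : P), F (g * (p : G)) = p⁻¹ • F g) ∧
    (∀ k ∈ K, ∀ g : G, F (k⁻¹ * g) = F g)}
  zero_mem' := by
    refine ⟨fun g p => ?_, fun k hk g => ?_⟩ <;> simp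
  add_mem' := by
    rintro F₁ F₂ ⟨h₁, h₁'⟩ ⟨h₂, h₂'⟩
    refine ⟨fun g p => ?_, fun k hk g => ?_⟩
    · simp only [Pi.add_apply, h₁ g p, h₂ g p, smul_add]
    · simp only [Pi.add_apply, h₁' k hk g, h₂' k hk g]
  neg_mem' := by
    rintro F ⟨h, h'⟩
    refine ⟨fun g p => ?_, fun k hk g => ?_⟩
    · simp only [Pi.neg_apply, h g p, smul_neg]
    · simp only [Pi.neg_apply, h' k hk g]

/-- The `(K ∩ P)`-invariants of `M`. -/
def fixInvariants : AddSubgroup M where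
  carrier := {m | ∀ p : P, (p : G) ∈ K → p • m = m}
  zero_mem' := fun p _ => smul_zero _
  add_mem' := by
    intro a b ha hb p hp
    rw [smul_add, ha p hp, hb p hp]
  neg_mem' := by
    intro a ha p hp
    rw [smul_neg, ha p hp]

variable {K P M}

theorem apply_mul_of_mem_indInvariants {F : G → M} (hF : F ∈ indInvariants K P M)
    {k : G} (hk : k ∈ K) (p : P) : F (k * p) = p⁻¹ • F 1 := by
  have h := hF.2 k⁻¹ (inv_mem hk) 1
  rw [inv_inv, mul_one] at h
  rw [hF.1, h]

theorem apply_one_mem_fixInvariants {F : G → M} (hF : F ∈ indInvariants K P M) :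
    F 1 ∈ fixInvariants K P M := by
  intro p hp
  have h := apply_mul_of_mem_indInvariants hF (inv_mem hp) p
  rw [inv_mul_cancel] at h
  exact eq_inv_smul_iff.mp h

theorem inv_smul_eq_inv_smul_of_mem_fixInvariants {m : M} (hm : m ∈ fixInvariants K P M)
    {k₁ k₂ : G} (hk₁ : k₁ ∈ K) (hk₂ : k₂ ∈ K) {p₁ p₂ : P} (h : k₁ * p₁ = k₂ * p₂) :
    p₁⁻¹ • m = p₂⁻¹ • m := by
  have hK : ((p₂ * p₁⁻¹ : P) : G) ∈ K := by
    have : ((p₂ * p₁⁻¹ : P) : G) = k₂⁻¹ * k₁ := by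
      rw [Subgroup.coe_mul, Subgroup.coe_inv, mul_inv_eq_iff_eq_mul, mul_assoc, h,
        inv_mul_cancel_left]
    rw [this]
    exact mul_mem (inv_mem hk₂) hk₁
  rw [eq_inv_smul_iff, ← mul_smul]
  exact hm _ hK

theorem exists_mem_indInvariants_apply_one_eq (hKP : ∀ g : G, ∃ k ∈ K, ∃ p ∈ P, g = k * p)
    {m : M} (hm : m ∈ fixInvariants K P M) : ∃ F ∈ indInvariants K P M, F 1 = m := by
  choose κ hκ π hπ hg using hKP
  let F : G → M := fun g => (⟨π g, hπ g⟩ : P)⁻¹ • m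
  have hF {g k : G} (hk : k ∈ K) (p : P) (h : g = k * p) : F g = p⁻¹ • m :=
    inv_smul_eq_inv_smul_of_mem_fixInvariants hm (hκ g) hk ((hg g).symm.trans h)
  refine ⟨F, ⟨fun g p => ?_, fun k hk g => ?_⟩, ?_⟩
  · rw [hF (hκ g) (⟨π g, hπ g⟩ * p) (by rw [Subgroup.coe_mul, ← mul_assoc, ← hg]),
      mul_inv_rev, mul_smul]
  · exact hF (mul_mem (inv_mem hk) (hκ g)) ⟨π g, hπ g⟩ (by rw [mul_assoc, ← hg])
  · rw [hF (one_mem K) 1 (by simp), inv_one, one_smul]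

variable (K P M)

/-- Evaluation at the identity, from `(Ind_P^G M)^K` to `M^(K ∩ P)`. -/
def indInvariantsEvalOne : indInvariants K P M →+ fixInvariants K P M where
  toFun F := ⟨(F : G → M) 1, apply_one_mem_fixInvariants F.2⟩
  map_zero' := rfl
  map_add' _ _ := rfl

theorem indInvariantsEvalOne_bijective (hKP : ∀ g : G, ∃ k ∈ K, ∃ p ∈ P, g = k * p) :
    Function.Bijective (indInvariantsEvalOne K P M) := by
  refine ⟨fun F₁ F₂ h => Subtype.ext (funext fun g => ?_), fun m => ?_⟩
  · obtain ⟨k, hk, p, hp, rfl⟩ := hKP g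
    have h₁ : (F₁ : G → M) 1 = (F₂ : G → M) 1 := congrArg Subtype.val h
    rw [apply_mul_of_mem_indInvariants F₁.2 hk ⟨p, hp⟩,
      apply_mul_of_mem_indInvariants F₂.2 hk ⟨p, hp⟩, h₁]
  · obtain ⟨F, hF, h⟩ := exists_mem_indInvariants_apply_one_eq hKP m.2
    exact ⟨⟨F, hF⟩, Subtype.ext h⟩

/-- If `G = K · P` (Iwasawa decomposition), then evaluation at the identity gives an
isomorphism of abelian groups `(Ind_P^G M)^K ≃ M^(K ∩ P)`. -/
theorem indInvariants_addEquiv_fixInvariants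
    (hKP : ∀ g : G, ∃ k ∈ K, ∃ p ∈ P, g = k * p) :
    ∃ e : indInvariants K P M ≃+ fixInvariants K P M,
      ∀ F : indInvariants K P M, (e F : M) = (F : G → M) 1 := by
  exact ⟨AddEquiv.ofBijective _ (indInvariantsEvalOne_bijective K P M hKP), fun _ => rfl⟩

end
end
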